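/- arXiv:1308.1161 — 2 statements merged into one kernel-verified Lean document; each statement's English description precedes it below -/
import Mathlib

section
/- Feng–Xiang setting; let t be an odd prime with t > 4N³√q (real square root), let γ be a primitive element of F_{q^t}, ω = γ^{(q^t−1)/(q−1)}, let D = ⋃_{i∈I} ω^i⟨ω^N⟩ be the Feng–Xiang skew Hadamard difference set with index set I, D' = ⋃_{i∈I} γ^i⟨γ^N⟩ its lift to F_{q^t}, and let t^{-1} denote the inverse of t modulo N. Fix a ∈ F_p^* \ {1}. If the set of integers {T_{ω^ℓ,a}(D^{(t^{-1})}) : 0 ≤ ℓ ≤ N−1} contains exactly u distinct elements, then the set {T_{γ^ℓ,a}(D') mod t : 0 ≤ ℓ ≤ N−1} ⊆ Z/tZ also contains exactly u distinct elements. -/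
/-- The triple intersection number `T_{β,a}(D) = |D ∩ (D - β) ∩ (D - aβ)|`. -/
noncomputable def tripleInt {F : Type*} [Field F] (β a : F) (D : Set F) : ℕ :=
  Set.ncard {x : F | x ∈ D ∧ x + β ∈ D ∧ x + a * β ∈ D}

section Helpers

open Polynomial

/-- `G` divides `h^l` times each of its Hasse derivatives. -/
def HD {F : Type*} [Field F] (h G : F[X]) : Prop := ∀ l, G ∣ h ^ l * hasseDeriv l G

lemma HD_mul_aux {F : Type*} [Field F] {h G P Q : F[X]} (l : ℕ)
    (H1 : ∀ l, P ∣ h ^ l * hasseDeriv l P) (H2 : ∀ l, Q ∣ h ^ l * hasseDeriv l G) :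
    P * Q ∣ h ^ l * hasseDeriv l (P * G) := by
  rw [hasseDeriv_mul, Finset.mul_sum]
  apply Finset.dvd_sum
  rintro ⟨i, j⟩ hij
  rw [Finset.HasAntidiagonal.mem_antidiagonal] at hij
  simp only at hij ⊢
  rw [← hij, pow_add]
  have := mul_dvd_mul (H1 i) (H2 j)
  convert this using 1
  ring

lemma HD.mul {F : Type*} [Field F] {h P Q : F[X]} (H1 : HD h P) (H2 : HD h Q) : HD h (P * Q) :=
  fun l => HD_mul_aux l H1 H2

lemma HD.one {F : Type*} [Field F] {h : F[X]} : HD h 1 := fun l => one_dvd _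

lemma HD.pow {F : Type*} [Field F] {h P : F[X]} (H1 : HD h P) (n : ℕ) : HD h (P ^ n) := by
  induction n with
  | zero => simpa using HD.one
  | succ n ih => rw [pow_succ]; exact ih.mul H1

lemma HD.lin {F : Type*} [Field F] {h : F[X]} (a : F) (ha : X - C a ∣ h) : HD h (X - C a) := by
  intro l
  rcases l with _ | _ | l
  · simp
  · simpa [hasseDeriv_one'] using ha
  · rw [hasseDeriv_eq_zero_of_lt_natDegree]
    · simp
    · rw [natDegree_X_sub_C]; omega

lemma HD.prod {F : Type*} [Field F] {h : F[X]} {ι : Type*} (s : Finset ι) (P : ι → F[X])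
    (H : ∀ i ∈ s, HD h (P i)) : HD h (∏ i ∈ s, P i) := by
  classical
  induction s using Finset.induction_on with
  | empty => simpa using HD.one
  | insert a s ha ih =>
    rw [Finset.prod_insert ha]
    exact (H a (by simp)).mul (ih fun i hi => H i (by simp [hi]))

lemma HD.apply {F : Type*} [Field F] {h G : F[X]} (H : HD h G) (r : F[X]) (l : ℕ) :
    G ∣ h ^ l * hasseDeriv l (r * G) := by
  rw [hasseDeriv_mul, Finset.mul_sum]
  apply Finset.dvd_sum
  rintro ⟨i, j⟩ hij
  rw [Finset.HasAntidiagonal.mem_antidiagonal] at hij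
  simp only at hij ⊢
  rw [← hij, pow_add]
  have := (H j).mul_left (h ^ i * hasseDeriv i r)
  convert this using 1
  ring

lemma HD.exists_quot {F : Type*} [Field F] {h G : F[X]} (H : HD h G) (hG : G ≠ 0) (l : ℕ) :
    ∃ L : F[X] →ₗ[F] F[X], ∀ r, L r * G = h ^ l * hasseDeriv l (r * G) := by
  choose f hf using fun r => H.apply r l
  refine ⟨{ toFun := f, map_add' := ?_, map_smul' := ?_ }, ?_⟩
  · intro x y
    apply mul_left_cancel₀ hG
    rw [← hf, mul_add, ← hf, ← hf, add_mul, map_add, mul_add]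
  · intro c x
    apply mul_left_cancel₀ hG
    rw [← hf, RingHom.id_apply, mul_smul_comm, ← hf, smul_mul_assoc, map_smul, mul_smul_comm]
  · intro r
    show f r * G = _
    rw [hf r]; ring

/-- Low Hasse derivatives vanish. -/
def HV {F : Type*} [Field F] (q : ℕ) (G : F[X]) : Prop := ∀ l, 0 < l → l < q → hasseDeriv l G = 0

lemma HV.mul_apply {F : Type*} [Field F] {q : ℕ} {G : F[X]} (H : HV q G) (P : F[X]) (l : ℕ)
    (hl : l < q) : hasseDeriv l (P * G) = hasseDeriv l P * G := by
  rw [hasseDeriv_mul, Finset.sum_eq_single (l, 0)]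
  · simp
  · rintro ⟨i, j⟩ hij hne
    rw [Finset.HasAntidiagonal.mem_antidiagonal] at hij
    simp only at hij ⊢
    rw [H j, mul_zero]
    · rcases Nat.eq_zero_or_pos j with rfl | h
      · exact absurd (by simp at hij; simp [hij]) hne
      · exact h
    · omega
  · intro h; simp at h

lemma HV.mul {F : Type*} [Field F] {q : ℕ} {G P : F[X]} (H : HV q G) (H' : HV q P) :
    HV q (P * G) := by
  intro l h0 hl
  rw [H.mul_apply P l hl, H' l h0 hl, zero_mul]

lemma HV.pow {F : Type*} [Field F] {q : ℕ} {G : F[X]} (H : HV q G) (j : ℕ) :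
    HV q (G ^ j) := by
  induction j with
  | zero => intro l h0 _; simp [hasseDeriv_apply_one _ h0]
  | succ n ih => rw [pow_succ]; exact H.mul ih

lemma HV_lin {F : Type*} [Field F] (p e : ℕ) [Fact p.Prime] [CharP F p] (a : F) :
    HV (p ^ e) ((X - C a) ^ (p ^ e)) := by
  intro l h0 hl
  rw [sub_pow_char_pow, map_sub, ← C_pow, hasseDeriv_C _ _ h0, sub_zero, ← monomial_one_right_eq_X_pow,
    hasseDeriv_monomial]
  have : p ∣ (p ^ e).choose l := Nat.Prime.dvd_choose_pow Fact.out h0.ne' hl.ne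
  rw [(CharP.cast_eq_zero_iff F p _).2 this]
  simp

lemma dvd_of_hasse {F : Type*} [Field F] (R : F[X]) (x : F) (M : ℕ)
    (H : ∀ l < M, (hasseDeriv l R).eval x = 0) : (X - C x) ^ M ∣ R := by
  have h1 : X ^ M ∣ taylor x R := by
    rw [X_pow_dvd_iff]
    intro d hd
    rw [taylor_coeff, H d hd]
  have h2 := (map_dvd (taylorEquiv (-x)) h1)
  simp only [map_pow] at h2
  have e1 : (taylorEquiv (-x)) (X : F[X]) = X - C x := by
    change taylor (-x) X = _
    rw [taylor_X]; simp [sub_eq_add_neg]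
  have e2 : (taylorEquiv (-x)) (taylor x R) = R := by
    change taylor (-x) (taylor x R) = _
    rw [taylor_taylor]; simp
  rwa [e1, e2] at h2

lemma card_mul_le_natDegree {F : Type*} [Field F] (R : F[X]) (hR : R ≠ 0) (Z : Finset F) (M : ℕ)
    (H : ∀ x ∈ Z, (X - C x) ^ M ∣ R) : M * Z.card ≤ R.natDegree := by
  have h : ∏ x ∈ Z, (X - C x) ^ M ∣ R := by
    apply Finset.prod_dvd_of_coprime
    · intro x hx y hy hxy
      exact (IsCoprime.pow (pairwise_coprime_X_sub_C Function.injective_id hxy))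
    · exact H
  have := natDegree_le_of_dvd h hR
  rw [natDegree_prod_of_monic _ _ (fun i _ => (monic_X_sub_C i).pow M)] at this
  simpa [mul_comm] using this

lemma quot_degree {F : Type*} [Field F] {h G : F[X]} (hG : G ≠ 0) (hh : h.natDegree ≤ 3)
    (l B : ℕ) (r s : F[X]) (hr : r ∈ degreeLT F B) (hs : s * G = h ^ l * hasseDeriv l (r * G)) :
    s ∈ degreeLT F (B + 2 * l) := by
  by_cases s0 : s = 0
  · rw [s0]; exact Submodule.zero_mem _
  have hsG : s * G ≠ 0 := mul_ne_zero s0 hG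
  have hr0 : r ≠ 0 := by
    rintro rfl
    simp at hs; tauto
  have hD : hasseDeriv l (r * G) ≠ 0 := by
    intro h0; rw [h0, mul_zero] at hs; exact hsG hs
  have hl : l ≤ (r * G).natDegree := by
    by_contra hlt
    exact hD (hasseDeriv_eq_zero_of_lt_natDegree _ _ (by omega))
  rw [mem_degreeLT] at hr ⊢
  have hrB : r.natDegree < B := (natDegree_lt_iff_degree_lt hr0).2 hr
  rw [← natDegree_lt_iff_degree_lt s0]
  have h1 : (s * G).natDegree = s.natDegree + G.natDegree := natDegree_mul s0 hG
  have h2 : (r * G).natDegree = r.natDegree + G.natDegree := natDegree_mul hr0 hG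
  have h3 : (h ^ l * hasseDeriv l (r * G)).natDegree ≤ l * 3 + ((r * G).natDegree - l) := by
    refine natDegree_mul_le.trans (add_le_add ?_ (natDegree_hasseDeriv_le _ _))
    exact natDegree_pow_le.trans (Nat.mul_le_mul_left _ hh)
  rw [← hs, h1] at h3
  omega

lemma finrank_unknowns {F : Type*} [Field F] {κ : Type*} [Fintype κ] (J B : ℕ) :
    Module.finrank F (κ → Fin J → Fin B → F) = Fintype.card κ * (J * B) := by
  rw [Module.finrank_pi_fintype]
  simp [Module.finrank_pi_fintype]

lemma finrank_conds {F : Type*} [Field F] (J B M : ℕ) :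
    Module.finrank F ((l : Fin M) → Fin (B + 2 * (l : ℕ) + J) → F) ≤ M * (B + J + M) := by
  rw [Module.finrank_pi_fintype]
  simp only [Module.finrank_pi_fintype, Module.finrank_self,
    Finset.sum_const, Finset.card_univ, Fintype.card_fin, smul_eq_mul, mul_one]
  have : ∑ l : Fin M, (B + 2 * (l : ℕ) + J) = M * (B + J) + M * (M - 1) := by
    rw [← Finset.sum_range_id_mul_two, ← Fin.sum_univ_eq_sum_range (fun i => i)]
    simp only [Finset.sum_add_distrib, ← Finset.mul_sum, Finset.sum_const, Finset.card_univ,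
      Fintype.card_fin, smul_eq_mul]
    ring
  rw [this, mul_add M (B + J) M]
  gcongr
  omega

lemma exists_solution {F : Type*} [Field F] {κ : Type*} [Fintype κ] (J B M : ℕ)
    (Q : κ → ℕ → ℕ → F[X] →ₗ[F] F[X])
    (hdeg : ∀ k l j r, j < J → r ∈ degreeLT F B → Q k l j r ∈ degreeLT F (B + 2 * l + J))
    (hcount : M * (B + J + M) < Fintype.card κ * (J * B)) :
    ∃ r : κ → Fin J → F[X], (∀ k j, r k j ∈ degreeLT F B) ∧ (∃ k j, r k j ≠ 0) ∧
      ∀ l < M, ∑ k, ∑ j : Fin J, Q k l j (r k j) = 0 := by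
  let P : (Fin B → F) →ₗ[F] F[X] := (degreeLT F B).subtype ∘ₗ (degreeLTEquiv F B).symm.toLinearMap
  have hP : ∀ v, P v ∈ degreeLT F B := fun v => ((degreeLTEquiv F B).symm v).2
  have hPinj : ∀ v, P v = 0 → v = 0 := by
    intro v hv
    have : (degreeLTEquiv F B).symm v = 0 := Subtype.ext hv
    simpa using this
  clear_value P
  let Λ : (κ → Fin J → Fin B → F) →ₗ[F] ((l : Fin M) → Fin (B + 2 * (l : ℕ) + J) → F) :=
    LinearMap.pi fun l => LinearMap.pi fun i => (lcoeff F i) ∘ₗ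
      (∑ k, ∑ j : Fin J, (Q k l j) ∘ₗ P ∘ₗ (LinearMap.proj j) ∘ₗ (LinearMap.proj k))
  have hΛ : ∀ r l i, Λ r l i = (∑ k, ∑ j : Fin J, Q k l j (P (r k j))).coeff i := by
    intro r l i
    simp [Λ, LinearMap.sum_apply]
  clear_value Λ
  have hker : LinearMap.ker Λ ≠ ⊥ := by
    apply LinearMap.ker_ne_bot_of_finrank_lt
    rw [finrank_unknowns]
    exact (finrank_conds J B M).trans_lt hcount
  obtain ⟨r, hrk, hr0⟩ := Submodule.exists_mem_ne_zero_of_ne_bot hker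
  refine ⟨fun k j => P (r k j), fun k j => hP _, ?_, ?_⟩
  · by_contra hcon
    push Not at hcon
    exact hr0 (funext fun k => funext fun j => hPinj _ (hcon k j))
  · intro l hl
    ext i
    rw [coeff_zero]
    by_cases hi : i < B + 2 * l + J
    · rw [← hΛ r ⟨l, hl⟩ ⟨i, hi⟩, LinearMap.mem_ker.1 hrk]; rfl
    · have hm : ∑ k, ∑ j : Fin J, Q k l j (P (r k j)) ∈ degreeLT F (B + 2 * l + J) :=
        Submodule.sum_mem _ fun k _ => Submodule.sum_mem _ fun j _ => hdeg k l j _ j.2 (hP _)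
      rw [mem_degreeLT] at hm
      apply coeff_eq_zero_of_degree_lt
      exact hm.trans_le (by exact_mod_cast not_lt.1 hi)

set_option maxHeartbeats 400000 in
theorem stepanov_core {F : Type*} [Field F] (p e q : ℕ) [Fact p.Prime] [CharP F p]
    (hq : q = p ^ e) (hF : ∀ x : F, x ^ q = x) {κ : Type*} [Fintype κ] (J B M D : ℕ)
    (hJ : 1 ≤ J)
    (pt : Fin 3 → F) (i0 : Fin 3) (A : κ → Fin 3 → ℕ) (z : κ → F) (Z : Finset F)
    (hZ : ∀ x ∈ Z, (∀ i, x ≠ pt i) ∧ ∀ k, ∏ i, (x - pt i) ^ A k i = z k)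
    (hdeg : ∀ k, ∑ i, A k i ≤ D)
    (hind : ∀ r : κ → Fin J → F[X], (∀ k j, r k j ∈ degreeLT F B) →
      (∑ k, ∑ j, r k j * (∏ i, (X - C (pt i)) ^ A k i) * ((X - C (pt i0)) ^ q) ^ (j : ℕ) = 0) →
      ∀ k j, r k j = 0)
    (hM : M ≤ q) (hcount : M * (B + J + M) < Fintype.card κ * (J * B)) :
    M * Z.card + q ≤ B + D + q * J := by
  classical
  obtain ⟨h, hh⟩ : ∃ h : F[X], h = ∏ i : Fin 3, (X - C (pt i)) := ⟨_, rfl⟩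
  set G : κ → F[X] := fun k => ∏ i, (X - C (pt i)) ^ A k i with hGdef
  have hGm : ∀ k, (G k).Monic := fun k => monic_prod_of_monic _ _ fun i _ => (monic_X_sub_C _).pow _
  have hG0 : ∀ k, G k ≠ 0 := fun k => (hGm k).ne_zero
  have hGdeg : ∀ k, (G k).natDegree ≤ D := by
    intro k
    rw [hGdef, natDegree_prod_of_monic _ _ (fun i _ => (monic_X_sub_C _).pow _)]
    simpa using hdeg k
  have hhdeg : h.natDegree ≤ 3 := by
    rw [hh, natDegree_prod_of_monic _ _ (fun i _ => (monic_X_sub_C _))]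
    simp
  have hHD : ∀ k, HD h (G k) := fun k => HD.prod _ _ fun i _ =>
    (HD.lin (pt i) (by rw [hh]; exact Finset.dvd_prod_of_mem _ (Finset.mem_univ i))).pow _
  choose L hL using fun k l => (hHD k).exists_quot (hG0 k) l
  set Y : F[X] := X - C (pt i0) with hY
  obtain ⟨r, hrB, hr0, hQ0⟩ := exists_solution J B M
    (fun k l j => (LinearMap.mulLeft F (C (z k) * Y ^ j)) ∘ₗ (L k l)) (by
      intro k l j r hj hr
      have h1 := quot_degree (hG0 k) hhdeg l B _ _ hr (hL k l r)
      rw [mem_degreeLT] at h1 ⊢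
      rw [LinearMap.comp_apply, LinearMap.mulLeft_apply]
      by_cases h0 : L k l r = 0
      · rw [h0, mul_zero, degree_zero]; exact WithBot.bot_lt_coe _
      have h2 : (L k l r).natDegree < B + 2 * l := (natDegree_lt_iff_degree_lt h0).2 h1
      refine degree_le_natDegree.trans_lt ?_
      rw [Nat.cast_lt]
      have h3 : (C (z k) * Y ^ (j : ℕ)).natDegree ≤ j := by
        refine (natDegree_C_mul_le _ _).trans (natDegree_pow_le.trans ?_)
        simp [Y]
      have h4 := natDegree_mul_le (p := C (z k) * Y ^ (j : ℕ)) (q := L k l r)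
      omega) hcount
  simp only [LinearMap.comp_apply, LinearMap.mulLeft_apply] at hQ0
  set R : F[X] := ∑ k, ∑ j : Fin J, r k j * G k * (Y ^ q) ^ (j : ℕ) with hR
  have hRne : R ≠ 0 := by
    intro h0
    obtain ⟨k, j, hkj⟩ := hr0
    exact hkj (hind r hrB h0 k j)
  have hBpos : 0 < B := by
    rcases Nat.eq_zero_or_pos B with h0 | h0
    · subst h0; simp at hcount
    · exact h0
  have hRdeg : R.natDegree ≤ (B - 1) + D + q * (J - 1) := by
    refine natDegree_sum_le_of_forall_le _ _ fun k _ => natDegree_sum_le_of_forall_le _ _ fun j _ => ?_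
    refine natDegree_mul_le.trans (add_le_add (natDegree_mul_le.trans (add_le_add ?_ (hGdeg k))) ?_)
    · by_cases h0 : r k j = 0
      · simp [h0]
      · have := (natDegree_lt_iff_degree_lt h0).2 (mem_degreeLT.1 (hrB k j))
        omega
    · rw [← pow_mul]
      refine natDegree_pow_le.trans ?_
      rw [hY, natDegree_X_sub_C, mul_one]
      have := j.2
      gcongr
      omega
  have hdvd : ∀ x ∈ Z, (X - C x) ^ M ∣ R := by
    intro x hx
    apply dvd_of_hasse
    intro l hl
    have hhx : h.eval x ≠ 0 := by
      rw [hh, eval_prod, Finset.prod_ne_zero_iff]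
      intro i _
      simpa [sub_eq_zero] using (hZ x hx).1 i
    have hGx : ∀ k, (G k).eval x = z k := by
      intro k
      rw [← (hZ x hx).2 k, hGdef, eval_prod]
      simp
    have key : h.eval x ^ l * (hasseDeriv l R).eval x = (∑ k, ∑ j : Fin J, C (z k) * Y ^ (j : ℕ) * L k l (r k j)).eval x := by
      rw [hR, map_sum, eval_finsetSum, eval_finsetSum, Finset.mul_sum]
      refine Finset.sum_congr rfl fun k _ => ?_
      rw [map_sum, eval_finsetSum, eval_finsetSum, Finset.mul_sum]
      refine Finset.sum_congr rfl fun j _ => ?_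
      have hv : HV q ((Y ^ q) ^ (j : ℕ)) := by
        apply HV.pow
        rw [hY, hq]
        exact HV_lin p e _
      rw [hv.mul_apply _ l (lt_of_lt_of_le hl hM)]
      have h1 := congrArg (eval x) (hL k l (r k j))
      simp only [eval_mul, eval_pow, eval_C] at h1 ⊢
      rw [← mul_assoc, ← h1, hGx, hF]
      ring
    rw [hQ0 l hl, eval_zero] at key
    exact (mul_eq_zero.1 key).resolve_left (pow_ne_zero _ hhx)
  have hfin := (card_mul_le_natDegree R hRne Z M hdvd).trans hRdeg
  obtain ⟨J', rfl⟩ : ∃ J', J = J' + 1 := ⟨J - 1, by omega⟩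
  rw [Nat.add_sub_cancel] at hfin
  rw [mul_add, mul_one]
  omega

lemma window {F : Type*} [Field F] (Y : F[X]) (hY : Y ≠ 0) {ι : Type*} [Fintype ι]
    (m : ι → ℕ) (P : ι → F[X]) (V : ℕ)
    (hgap : ∀ i j, i ≠ j → m i + V ≤ m j ∨ m j + V ≤ m i)
    (hP : ∀ i, Y ^ V ∣ P i → P i = 0) (hsum : ∑ i, Y ^ m i * P i = 0) : ∀ i, P i = 0 := by
  classical
  by_contra hcon
  push Not at hcon
  have hne : (Finset.univ.filter fun i => P i ≠ 0).Nonempty := by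
    obtain ⟨i, hi⟩ := hcon
    exact ⟨i, by simp [hi]⟩
  obtain ⟨i, hi, hmin⟩ := Finset.exists_min_image _ m hne
  rw [Finset.mem_filter] at hi
  apply hi.2
  apply hP
  rw [← Finset.add_sum_erase _ _ (Finset.mem_univ i)] at hsum
  have h1 : Y ^ (m i + V) ∣ Y ^ m i * P i := by
    rw [eq_neg_of_add_eq_zero_left hsum, dvd_neg]
    apply Finset.dvd_sum
    intro j hj
    by_cases h0 : P j = 0
    · rw [h0, mul_zero]; exact dvd_zero _
    have hij : i ≠ j := fun h => by simp [h] at hj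
    have hle := hmin j (by simp [h0])
    apply Dvd.dvd.mul_right
    apply pow_dvd_pow
    rcases hgap i j hij with h | h <;> omega
  rw [pow_add] at h1
  exact (mul_dvd_mul_iff_left (pow_ne_zero _ hY)).1 h1

lemma gap_lemma (N c q n d J : ℕ) [NeZero N] (hq : q = N * c + 1) (hN : N = n * d) (hJ : J ≤ c * d)
    (β : ZMod N) (hβ : addOrderOf β = n) (k k' : Fin n) (j j' : Fin J) (hne : (k, j) ≠ (k', j')) :
    (c * ((k : ℕ) • β).val + q * j) + (c * d - J) ≤ c * ((k' : ℕ) • β).val + q * j' ∨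
    (c * ((k' : ℕ) • β).val + q * j') + (c * d - J) ≤ c * ((k : ℕ) • β).val + q * j := by
  have hnpos : 0 < n := k.pos
  have hdpos : 0 < d := by
    rcases Nat.eq_zero_or_pos d with h | h
    · exact absurd (by rw [hN, h, mul_zero]) (NeZero.ne N)
    · exact h
  have hdvd : ∀ k : ℕ, d ∣ (k • β).val := by
    intro k
    have h1 : ((n * (k • β).val : ℕ) : ZMod N) = 0 := by
      rw [Nat.cast_mul, ZMod.natCast_val, ZMod.cast_id, ← nsmul_eq_mul, ← mul_nsmul', mul_comm,
        mul_nsmul', ← hβ, addOrderOf_nsmul_eq_zero, smul_zero]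
    rw [ZMod.natCast_eq_zero_iff] at h1
    have h2 : n * d ∣ n * (k • β).val := by rwa [← hN]
    exact (Nat.mul_dvd_mul_iff_left hnpos).1 h2
  have hv := ZMod.val_lt ((k : ℕ) • β)
  have hv' := ZMod.val_lt ((k' : ℕ) • β)
  obtain ⟨s, hs⟩ : ∃ s, s = ((k : ℕ) • β).val + N * j := ⟨_, rfl⟩
  obtain ⟨s', hs'⟩ : ∃ s', s' = ((k' : ℕ) • β).val + N * j' := ⟨_, rfl⟩
  have e1 : c * ((k : ℕ) • β).val + q * j = c * s + j := by rw [hs, hq]; ring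
  have e2 : c * ((k' : ℕ) • β).val + q * j' = c * s' + j' := by rw [hs', hq]; ring
  have hd1 : d ∣ s := by rw [hs]; exact dvd_add (hdvd _) (by rw [hN]; exact ⟨n * j, by ring⟩)
  have hd2 : d ∣ s' := by rw [hs']; exact dvd_add (hdvd _) (by rw [hN]; exact ⟨n * j', by ring⟩)
  have hss : s ≠ s' := by
    intro h
    rw [hs, hs'] at h
    have hj : (j : ℕ) = j' := by
      have h5 : (((k : ℕ) • β).val + N * j) / N = (((k' : ℕ) • β).val + N * j') / N := by rw [h]
      rwa [Nat.add_mul_div_left _ _ (NeZero.pos N), Nat.add_mul_div_left _ _ (NeZero.pos N),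
        Nat.div_eq_of_lt hv, Nat.div_eq_of_lt hv', zero_add, zero_add] at h5
    rw [hj] at h
    have h3 := ZMod.val_injective N (Nat.add_right_cancel h)
    have h4 := nsmul_injOn_Iio_addOrderOf (x := β) (by simp [hβ]) (by simp [hβ]) h3
    exact hne (by rw [Prod.mk.injEq]; exact ⟨Fin.ext h4, Fin.ext hj⟩)
  rw [e1, e2]
  obtain ⟨x, rfl⟩ := hd1
  obtain ⟨y, rfl⟩ := hd2
  have hj := j.2
  have hj' := j'.2
  rcases lt_or_gt_of_ne hss with h | h
  · left
    have hxy : x + 1 ≤ y := Nat.lt_of_mul_lt_mul_left h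
    have := Nat.mul_le_mul_left (c * d) hxy
    have r1 : c * (d * x) = c * d * x := by ring
    have r2 : c * (d * y) = c * d * y := by ring
    have r3 : c * d * (x + 1) = c * d * x + c * d := by ring
    omega
  · right
    have hxy : y + 1 ≤ x := Nat.lt_of_mul_lt_mul_left h
    have := Nat.mul_le_mul_left (c * d) hxy
    have r1 : c * (d * x) = c * d * x := by ring
    have r2 : c * (d * y) = c * d * y := by ring
    have r3 : c * d * (y + 1) = c * d * y + c * d := by ring
    omega

lemma coprime_erase {F : Type*} [Field F] (pt : Fin 3 → F) (hpt : Function.Injective pt)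
    (i0 : Fin 3) (A : Fin 3 → ℕ) (V : ℕ) :
    IsCoprime ((X - C (pt i0)) ^ V) (∏ i ∈ Finset.univ.erase i0, (X - C (pt i)) ^ A i) := by
  apply IsCoprime.prod_right
  intro i hi
  apply IsCoprime.pow
  apply pairwise_coprime_X_sub_C hpt
  rintro rfl
  simp at hi

theorem indep_full {F : Type*} [Field F] (N c q n d J : ℕ) [NeZero N] (hq : q = N * c + 1)
    (hN : N = n * d) (hJ : J ≤ c * d) (pt : Fin 3 → F) (hpt : Function.Injective pt) (i0 : Fin 3)
    (α : Fin 3 → ZMod N) (hα : addOrderOf (α i0) = n)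
    (r : Fin n → Fin J → F[X]) (hr : ∀ k j, r k j ∈ degreeLT F (c * d - J))
    (hsum : ∑ k, ∑ j, r k j * (∏ i, (X - C (pt i)) ^ (c * ((k : ℕ) • α i).val)) *
      ((X - C (pt i0)) ^ q) ^ (j : ℕ) = 0) : ∀ k j, r k j = 0 := by
  have hw := window (X - C (pt i0)) (X_sub_C_ne_zero _) (ι := Fin n × Fin J)
    (fun kj => c * ((kj.1 : ℕ) • α i0).val + q * kj.2)
    (fun kj => (∏ i ∈ Finset.univ.erase i0, (X - C (pt i)) ^ (c * ((kj.1 : ℕ) • α i).val)) *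
      r kj.1 kj.2) (c * d - J)
    (fun a b hab => gap_lemma N c q n d J hq hN hJ _ hα a.1 b.1 a.2 b.2 hab) ?_ ?_
  · intro k j
    have := hw (k, j)
    refine (mul_eq_zero.1 this).resolve_left ?_
    exact Finset.prod_ne_zero_iff.2 fun i _ => pow_ne_zero _ (X_sub_C_ne_zero _)
  · rintro ⟨k, j⟩ hdvd
    have h1 : (X - C (pt i0)) ^ (c * d - J) ∣ r k j :=
      (coprime_erase pt hpt i0 _ _).dvd_of_dvd_mul_left hdvd
    have h2 : r k j = 0 := by
      by_contra h0
      have h3 := natDegree_le_of_dvd h1 h0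
      have h4 := (natDegree_lt_iff_degree_lt h0).2 (mem_degreeLT.1 (hr k j))
      rw [natDegree_pow, natDegree_X_sub_C] at h3
      omega
    simp only [h2, mul_zero]
  · rw [Fintype.sum_prod_type, ← hsum]
    refine Finset.sum_congr rfl fun k _ => Finset.sum_congr rfl fun j _ => ?_
    rw [← Finset.mul_prod_erase _ _ (Finset.mem_univ i0), pow_add, ← pow_mul]
    ring

lemma pair_lemma {F : Type*} [Field F] (p e q : ℕ) [Fact p.Prime] [CharP F p]
    (hq : q = p ^ e) (hF : ∀ x : F, x ^ q = x) (pt : Fin 3 → F) (hpt : Function.Injective pt)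
    (i0 : Fin 3) (W : Fin 3 → ℕ) (hW0 : W i0 = 0) (hW : ∀ i, W i = 0 ∨ 2 * W i + 1 = q)
    (hW1 : ∃ i, W i ≠ 0) (B V : ℕ) (hV : 2 * B + 2 ≤ V) (hVq : V ≤ q) (r0 r1 : F[X])
    (h0 : r0 ∈ degreeLT F B) (h1 : r1 ∈ degreeLT F B)
    (hdvd : (X - C (pt i0)) ^ V ∣ r0 + r1 * ∏ i, (X - C (pt i)) ^ W i) : r0 = 0 ∧ r1 = 0 := by
  classical
  obtain ⟨U, hU⟩ : ∃ U : F[X], U = ∏ i, (X - C (pt i)) ^ W i := ⟨_, rfl⟩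
  obtain ⟨ε, hε⟩ : ∃ ε : Fin 3 → ℕ, ε = fun i => if W i = 0 then 0 else 1 := ⟨_, rfl⟩
  obtain ⟨H, hH⟩ : ∃ H : F[X], H = ∏ i, (X - C (pt i)) ^ ε i := ⟨_, rfl⟩
  rw [← hU] at hdvd
  have hUH : U ^ 2 * H = H ^ q := by
    rw [hU, hH, ← Finset.prod_pow, ← Finset.prod_pow, ← Finset.prod_mul_distrib]
    refine Finset.prod_congr rfl fun i _ => ?_
    rw [← pow_mul, ← pow_mul, ← pow_add]
    congr 1
    rw [hε]
    rcases hW i with h | h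
    · simp [h]
    · by_cases hz : W i = 0
      · simp [hz]
      · simp [hz]; omega
  have hHq : (X - C (pt i0)) ^ q ∣ H ^ q - C (H.eval (pt i0)) := by
    have : H ^ q - C (H.eval (pt i0)) = (H - C (H.eval (pt i0))) ^ q := by
      rw [hq, sub_pow_char_pow, ← hq, ← C_pow, hF]
    rw [this]
    exact pow_dvd_pow_of_dvd (X_sub_C_dvd_sub_C_eval) _
  have hHne : H.eval (pt i0) ≠ 0 := by
    rw [hH, eval_prod, Finset.prod_ne_zero_iff]
    intro i _
    by_cases hi : i = i0
    · subst hi; simp [hε, hW0]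
    · rw [eval_pow]
      apply pow_ne_zero
      simp only [eval_sub, eval_X, eval_C]
      rw [sub_ne_zero]
      exact fun h => hi (hpt h).symm
  have hHdeg : H.natDegree ≤ 3 := by
    rw [hH, natDegree_prod_of_monic _ _ (fun i _ => (monic_X_sub_C _).pow _)]
    calc ∑ i, ((X - C (pt i)) ^ ε i).natDegree ≤ ∑ i : Fin 3, 1 := by
          refine Finset.sum_le_sum fun i _ => ?_
          rw [natDegree_pow, natDegree_X_sub_C, hε]
          simp only; split_ifs <;> simp
      _ = 3 := by simp
  have hE : H * r0 ^ 2 - C (H.eval (pt i0)) * r1 ^ 2 = 0 := by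
    have hd : (X - C (pt i0)) ^ V ∣ H * r0 ^ 2 - C (H.eval (pt i0)) * r1 ^ 2 := by
      have e1 : H * r0 ^ 2 - C (H.eval (pt i0)) * r1 ^ 2 =
          (r0 + r1 * U) * (H * (r0 - r1 * U)) + (H ^ q - C (H.eval (pt i0))) * r1 ^ 2 := by
        rw [← hUH]; ring
      rw [e1]
      exact dvd_add (hdvd.mul_right _) (((pow_dvd_pow _ hVq).trans hHq).mul_right _)
    by_contra hne
    have h3 := natDegree_le_of_dvd hd hne
    rw [natDegree_pow, natDegree_X_sub_C] at h3
    have hdr : ∀ r ∈ degreeLT F B, r.natDegree ≤ B - 1 := by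
      intro r hr
      by_cases hz : r = 0
      · simp [hz]
      · have := (natDegree_lt_iff_degree_lt hz).2 (mem_degreeLT.1 hr)
        omega
    have hB : B ≠ 0 := by
      rintro rfl
      rw [mem_degreeLT] at h0 h1
      simp only [Nat.cast_zero] at h0 h1
      have z0 : r0 = 0 := by
        by_contra h; exact absurd (zero_le_degree_iff.2 h) (not_le.2 h0)
      have z1 : r1 = 0 := by
        by_contra h; exact absurd (zero_le_degree_iff.2 h) (not_le.2 h1)
      apply hne; simp [z0, z1]
    have h4 : (H * r0 ^ 2 - C (H.eval (pt i0)) * r1 ^ 2).natDegree ≤ 3 + 2 * (B - 1) := by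
      refine (natDegree_sub_le _ _).trans (max_le ?_ ?_)
      · exact natDegree_mul_le.trans (add_le_add hHdeg (natDegree_pow_le.trans
          (Nat.mul_le_mul_left _ (hdr _ h0))))
      · refine (natDegree_C_mul_le _ _).trans (natDegree_pow_le.trans ?_)
        have := Nat.mul_le_mul_left 2 (hdr _ h1)
        omega
    omega
  rw [sub_eq_zero] at hE
  have hr0 : r0 = 0 := by
    by_contra hr0
    obtain ⟨i1, hi1⟩ := hW1
    have hHz : H ≠ 0 := by rintro rfl; simp at hHne
    have hr1 : r1 ≠ 0 := by
      rintro rfl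
      simp at hE; tauto
    have hm := congrArg (rootMultiplicity (pt i1)) hE
    have hHm : rootMultiplicity (pt i1) H = 1 := by
      have hHe : H = (X - C (pt i1)) * ∏ i ∈ Finset.univ.erase i1, (X - C (pt i)) ^ ε i := by
        rw [hH, ← Finset.mul_prod_erase _ _ (Finset.mem_univ i1)]
        congr 1
        simp [hε, hi1]
      have hne : (∏ i ∈ Finset.univ.erase i1, (X - C (pt i)) ^ ε i).eval (pt i1) ≠ 0 := by
        rw [eval_prod, Finset.prod_ne_zero_iff]
        intro i hi
        rw [eval_pow]
        apply pow_ne_zero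
        simp only [eval_sub, eval_X, eval_C]
        rw [sub_ne_zero]
        intro h
        rw [hpt h] at hi
        simp at hi
      rw [hHe, rootMultiplicity_mul (by rw [← hHe]; exact hHz), rootMultiplicity_X_sub_C_self,
        rootMultiplicity_eq_zero hne]
    rw [rootMultiplicity_mul (mul_ne_zero hHz (pow_ne_zero _ hr0)), hHm, pow_two,
      rootMultiplicity_mul (mul_ne_zero hr0 hr0),
      rootMultiplicity_mul (mul_ne_zero (C_ne_zero.2 hHne) (pow_ne_zero _ hr1)), pow_two,
      rootMultiplicity_mul (mul_ne_zero hr1 hr1), rootMultiplicity_C] at hm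
    omega
  refine ⟨hr0, ?_⟩
  rw [hr0] at hE
  have : C (H.eval (pt i0)) * r1 ^ 2 = 0 := by rw [← hE]; ring
  have h5 := (mul_eq_zero.1 this).resolve_left (C_ne_zero.2 hHne)
  exact pow_eq_zero_iff (two_ne_zero) |>.1 h5

theorem indep_mixed {F : Type*} [Field F] (p e q : ℕ) [Fact p.Prime] [CharP F p]
    (hqp : q = p ^ e) (hF : ∀ x : F, x ^ q = x) (N c n d J B : ℕ) [NeZero N]
    (hq : q = N * c + 1)
    (hN : N = n * d) (hJ : J ≤ c * d) (pt : Fin 3 → F) (hpt : Function.Injective pt) (i0 : Fin 3)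
    (α : Fin 3 → ZMod N) (hα : addOrderOf (α i0) = n)
    (W : Fin 3 → ℕ) (hW0 : W i0 = 0) (hW : ∀ i, W i = 0 ∨ 2 * W i + 1 = q)
    (hW1 : ∃ i, W i ≠ 0) (hB : 2 * B + 2 ≤ c * d - J)
    (r : Fin n × Bool → Fin J → F[X]) (hr : ∀ k j, r k j ∈ degreeLT F B)
    (hsum : ∑ k, ∑ j, r k j * (∏ i, (X - C (pt i)) ^ (c * ((k.1 : ℕ) • α i).val +
        if k.2 then W i else 0)) *
      ((X - C (pt i0)) ^ q) ^ (j : ℕ) = 0) : ∀ k j, r k j = 0 := by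
  have hVq : c * d - J ≤ q := by
    have hn : n ≠ 0 := by rintro rfl; exact NeZero.ne N (by simpa using hN)
    have h1 : 1 * (c * d) ≤ n * (c * d) := Nat.mul_le_mul_right _ (Nat.one_le_iff_ne_zero.2 hn)
    have : N * c = n * (c * d) := by rw [hN]; ring
    omega
  have hw := window (X - C (pt i0)) (X_sub_C_ne_zero _) (ι := Fin n × Fin J)
    (fun kj => c * ((kj.1 : ℕ) • α i0).val + q * kj.2)
    (fun kj => (∏ i ∈ Finset.univ.erase i0, (X - C (pt i)) ^ (c * ((kj.1 : ℕ) • α i).val)) *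
      (r (kj.1, false) kj.2 + r (kj.1, true) kj.2 * ∏ i, (X - C (pt i)) ^ W i)) (c * d - J)
    (fun a b hab => gap_lemma N c q n d J hq hN hJ _ hα a.1 b.1 a.2 b.2 hab) ?_ ?_
  · have hz : ∀ k j, r (k, false) j = 0 ∧ r (k, true) j = 0 := by
      intro k j
      have := hw (k, j)
      have h1 := (mul_eq_zero.1 this).resolve_left
        (Finset.prod_ne_zero_iff.2 fun i _ => pow_ne_zero _ (X_sub_C_ne_zero _))
      exact pair_lemma p e q hqp hF pt hpt i0 W hW0 hW hW1 B _ hB hVq _ _ (hr _ _) (hr _ _)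
        (by simp only at h1; rw [h1]; exact dvd_zero _)
    rintro ⟨k, b⟩ j
    cases b
    · exact (hz k j).1
    · exact (hz k j).2
  · rintro ⟨k, j⟩ hdvd
    have h1 := (coprime_erase pt hpt i0 _ _).dvd_of_dvd_mul_left hdvd
    have h2 := pair_lemma p e q hqp hF pt hpt i0 W hW0 hW hW1 B _ hB hVq _ _ (hr _ _) (hr _ _) h1
    simp only at h2 ⊢
    rw [h2.1, h2.2]; simp
  · rw [Fintype.sum_prod_type, ← hsum, Fintype.sum_prod_type]
    refine Finset.sum_congr rfl fun k _ => ?_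
    rw [Fintype.sum_bool, ← Finset.sum_add_distrib]
    refine Finset.sum_congr rfl fun j _ => ?_
    simp only [if_true, Bool.false_eq_true, if_false, add_zero]
    simp only [pow_add, Finset.prod_mul_distrib]
    rw [← Finset.mul_prod_erase Finset.univ (fun i => (X - C (pt i)) ^ (c * ((k : ℕ) • α i).val)) (Finset.mem_univ i0)]
    simp only [pow_mul]
    ring

lemma prod_value {F : Type*} [Field F] (N c : ℕ) [NeZero N] (ω : F) (hω : ω ^ (N * c) = 1)
    (cl : F → ℕ) (hcl : ∀ x : F, x ≠ 0 → ω ^ cl x = x) (pt : Fin 3 → F) (α : Fin 3 → ZMod N)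
    (x : F) (hx : ∀ i, x ≠ pt i) (k : ℕ) :
    ∏ i, (x - pt i) ^ (c * (k • α i).val) =
      ω ^ (c * ((k : ZMod N) * ∑ i, α i * (cl (x - pt i) : ZMod N)).val) := by
  have h1 : ∀ i, (x - pt i) ^ (c * (k • α i).val) = ω ^ (c * (cl (x - pt i) * (k • α i).val)) := by
    intro i
    conv_lhs => rw [← hcl (x - pt i) (sub_ne_zero.2 (hx i))]
    rw [← pow_mul]
    congr 1; ring
  rw [Finset.prod_congr rfl fun i _ => h1 i, Finset.prod_pow_eq_pow_sum, ← Finset.mul_sum,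
    pow_mul, pow_mul]
  apply pow_eq_pow_of_modEq (n := N)
  · rw [← ZMod.natCast_eq_natCast_iff]
    push_cast
    simp only [ZMod.natCast_val, ZMod.cast_id', id_eq]
    rw [Finset.mul_sum]
    refine Finset.sum_congr rfl fun i _ => ?_
    rw [nsmul_eq_mul]; ring
  · rw [← pow_mul, mul_comm, hω]

theorem fiber_full {F : Type*} [Field F] [DecidableEq F] (p e q : ℕ) [Fact p.Prime] [CharP F p]
    (hqp : q = p ^ e) (hF : ∀ x : F, x ^ q = x) (N c n d J M : ℕ) [NeZero N]
    (hq : q = N * c + 1)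
    (hN : N = n * d) (hJ : J ≤ c * d) (hJ2 : 2 ≤ J)
    (pt : Fin 3 → F) (hpt : Function.Injective pt) (i0 : Fin 3)
    (α : Fin 3 → ZMod N) (hα : addOrderOf (α i0) = n)
    (ω : F) (hω : ω ^ (N * c) = 1)
    (cl : F → ℕ) (hcl : ∀ x : F, x ≠ 0 → ω ^ cl x = x)
    (θ : ZMod N) (Z : Finset F)
    (hZ : ∀ x ∈ Z, (∀ i, x ≠ pt i) ∧ ∑ i, α i * (cl (x - pt i) : ZMod N) = θ)
    (hM : M ≤ q) (hcount : M * (c * d + M) < n * (J * (c * d - J))) :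
    M * Z.card + q ≤ (c * d - J) + 5 * (N * c) + q * J := by
  refine stepanov_core p e q hqp hF (κ := Fin n) J (c * d - J) M (5 * (N * c)) (by omega) pt i0
    (fun k i => c * ((k : ℕ) • α i).val) (fun k => ω ^ (c * (((k : ℕ) : ZMod N) * θ).val)) Z
    ?_ ?_ ?_ hM ?_
  · intro x hx
    refine ⟨(hZ x hx).1, fun k => ?_⟩
    rw [prod_value N c ω hω cl hcl pt α x (hZ x hx).1 k, (hZ x hx).2]
  · intro k
    calc ∑ i, c * ((k : ℕ) • α i).val ≤ ∑ i : Fin 3, c * N :=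
          Finset.sum_le_sum fun i _ => Nat.mul_le_mul_left _ (ZMod.val_lt _).le
      _ = 3 * (N * c) := by simp; ring
      _ ≤ 5 * (N * c) := by omega
  · intro r hr hs
    exact indep_full N c q n d J hq hN hJ pt hpt i0 α hα r hr hs
  · rw [Fintype.card_fin]
    convert hcount using 2
    omega

theorem fiber_mixed {F : Type*} [Field F] [DecidableEq F] (p e q : ℕ) [Fact p.Prime] [CharP F p]
    (hqp : q = p ^ e) (hF : ∀ x : F, x ^ q = x) (N N' c n d J M : ℕ) [NeZero N] (hc : 0 < c)
    (hq : q = N * c + 1) (hNN : N = 2 * N')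
    (hN : N = 2 * n * d) (hJ : J ≤ c * d) (hJ2 : 2 ≤ J)
    (pt : Fin 3 → F) (hpt : Function.Injective pt) (i0 : Fin 3)
    (α : Fin 3 → ZMod N) (hα : addOrderOf (α i0) = n) (hn : Odd n)
    (hα1 : ∃ i, N' • α i ≠ 0)
    (ω : F) (hω : ω ^ (N * c) = 1)
    (cl : F → ℕ) (hcl : ∀ x : F, x ≠ 0 → ω ^ cl x = x)
    (θ : ZMod N) (Z : Finset F)
    (hZ : ∀ x ∈ Z, (∀ i, x ≠ pt i) ∧ ∑ i, α i * (cl (x - pt i) : ZMod N) = θ)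
    (hM : M ≤ q) (hcount : M * (c * d + M) < 2 * n * (J * (c * d - J))) :
    M * Z.card + q ≤ (c * d - J) + 5 * (N * c) + q * J := by
  have hval : ∀ i, (N' • α i).val = 0 ∨ (N' • α i).val = N' := by
    intro i
    have h1 : ((2 * (N' • α i).val : ℕ) : ZMod N) = 0 := by
      push_cast
      rw [ZMod.natCast_val, ZMod.cast_id', id_eq, nsmul_eq_mul, ← mul_assoc]
      have : (2 : ZMod N) * (N' : ZMod N) = ((2 * N' : ℕ) : ZMod N) := by push_cast; rfl
      rw [this, ← hNN]; simp
    rw [ZMod.natCast_eq_zero_iff] at h1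
    have h2 := ZMod.val_lt (N' • α i)
    obtain ⟨t, ht⟩ := h1
    generalize (N' • α i).val = v at ht h2 ⊢
    rw [hNN] at ht h2
    have ht2 : t < 2 := by
      by_contra h
      have := Nat.mul_le_mul_left (2 * N') (not_lt.1 h)
      rw [← ht] at this
      omega
    interval_cases t
    · left; omega
    · right; omega
  refine stepanov_core p e q hqp hF (κ := Fin n × Bool) J (c * d - J) M (5 * (N * c)) (by omega) pt i0
    (fun k i => c * ((k.1 : ℕ) • (2 • α i)).val + if k.2 then c * (N' • α i).val else 0)
    (fun k => ω ^ (c * (((k.1 * 2 : ℕ) : ZMod N) * θ).val) *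
      if k.2 then ω ^ (c * (((N' : ℕ) : ZMod N) * θ).val) else 1) Z
    ?_ ?_ ?_ hM ?_
  · intro x hx
    refine ⟨(hZ x hx).1, ?_⟩
    rintro ⟨k, b⟩
    simp only [pow_add, Finset.prod_mul_distrib, smul_smul]
    rw [prod_value N c ω hω cl hcl pt α x (hZ x hx).1 _, (hZ x hx).2]
    congr 1
    cases b
    · simp
    · simp only [if_true]
      rw [prod_value N c ω hω cl hcl pt α x (hZ x hx).1 _, (hZ x hx).2]
  · intro k
    calc ∑ i, (c * ((k.1 : ℕ) • (2 • α i)).val + if k.2 then c * (N' • α i).val else 0)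
          ≤ ∑ i : Fin 3, (c * N + c * N') := by
          refine Finset.sum_le_sum fun i _ => add_le_add
            (Nat.mul_le_mul_left _ (ZMod.val_lt _).le) ?_
          split_ifs
          · refine Nat.mul_le_mul_left _ ?_
            rcases hval i with h | h <;> omega
          · exact Nat.zero_le _
      _ = 3 * (N * c) + 3 * (N' * c) := by simp; ring
      _ ≤ 5 * (N * c) := by
        have : N * c = 2 * (N' * c) := by rw [hNN]; ring
        omega
  · intro r hr hs
    refine indep_mixed p e q hqp hF N c n (2 * d) J (c * d - J) hq (by rw [hN]; ring)
      (by rw [mul_left_comm]; omega) pt hpt i0 (fun i => 2 • α i) ?_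
      (fun i => c * (N' • α i).val) ?_ ?_ ?_ ?_ r hr hs
    · rw [Nat.Coprime.addOrderOf_nsmul, hα]
      rw [hα]; exact Nat.coprime_comm.1 (Nat.coprime_two_left.2 hn)
    · have : N' • α i0 = 0 := by
        rw [← addOrderOf_dvd_iff_nsmul_eq_zero, hα]
        have : N' = n * d := by
          have : 2 * N' = 2 * (n * d) := by rw [← hNN, hN]; ring
          omega
        exact ⟨d, this⟩
      simp [this]
    · intro i
      rcases hval i with h | h
      · left; simp only [h, mul_zero]
      · right; simp only [h]; rw [hq, hNN]; ring
    · obtain ⟨i, hi⟩ := hα1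
      refine ⟨i, Nat.mul_ne_zero hc.ne' ?_⟩
      rwa [Ne, ZMod.val_eq_zero]
    · rw [mul_left_comm c 2 d]; omega
  · rw [Fintype.card_prod, Fintype.card_fin, Fintype.card_bool, mul_comm n 2]
    convert hcount using 2
    omega

open ZMod in
theorem char_sum_bound {F : Type*} (N n d : ℕ) [NeZero N] (hN : N = n * d) (hn : 1 < n)
    (S : Finset F) (Θ : F → ZMod N) (hΘ : ∀ x ∈ S, n • Θ x = 0) (B0 : ℝ)
    (hB : ∀ θ : ZMod N, ((S.filter fun x => Θ x = θ).card : ℝ) ≤ B0) :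
    ‖∑ x ∈ S, stdAddChar (Θ x)‖ ≤ n * B0 - S.card := by
  classical
  have hd0 : 0 < d := by
    rcases Nat.eq_zero_or_pos d with h | h
    · exact absurd (by rw [hN, h, mul_zero]) (NeZero.ne N)
    · exact h
  have hrep : ∀ x ∈ S, ∃ j < n, (Θ x).val = d * j := by
    intro x hx
    have h1 : ((n * (Θ x).val : ℕ) : ZMod N) = 0 := by
      rw [Nat.cast_mul, ZMod.natCast_val, ZMod.cast_id, ← nsmul_eq_mul, hΘ x hx]
    rw [ZMod.natCast_eq_zero_iff] at h1
    have h2 : n * d ∣ n * (Θ x).val := by rwa [← hN]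
    obtain ⟨j, hj⟩ := (Nat.mul_dvd_mul_iff_left (by omega)).1 h2
    refine ⟨j, ?_, hj⟩
    have := ZMod.val_lt (Θ x)
    rw [hj, hN, mul_comm n d] at this
    exact Nat.lt_of_mul_lt_mul_left this
  let φ : F → ℕ := fun x => (Θ x).val / d
  have hφ : ∀ x ∈ S, φ x ∈ Finset.range n := by
    intro x hx
    obtain ⟨j, hj, h⟩ := hrep x hx
    simp [φ, h, Nat.mul_div_cancel_left _ hd0, hj]
  have hφΘ : ∀ x ∈ S, Θ x = ((d * φ x : ℕ) : ZMod N) := by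
    intro x hx
    obtain ⟨j, hj, h⟩ := hrep x hx
    simp only [φ]
    rw [h, Nat.mul_div_cancel_left _ hd0, ← h, ZMod.natCast_val, ZMod.cast_id]
  have hcard : ∀ j, ((S.filter fun x => φ x = j).card : ℝ) ≤ B0 := by
    intro j
    refine le_trans ?_ (hB ((d * j : ℕ) : ZMod N))
    norm_cast
    apply Finset.card_le_card
    intro x hx
    rw [Finset.mem_filter] at hx ⊢
    exact ⟨hx.1, by rw [hφΘ x hx.1, hx.2]⟩
  obtain ⟨ζ, hζ⟩ : ∃ ζ : ℂ, ζ = stdAddChar ((d : ℕ) : ZMod N) := ⟨_, rfl⟩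
  have hζj : ∀ j : ℕ, stdAddChar ((d * j : ℕ) : ZMod N) = ζ ^ j := by
    intro j
    rw [hζ, ← AddChar.map_nsmul_eq_pow, nsmul_eq_mul, mul_comm]
    push_cast; rfl
  have hζ1 : ζ ≠ 1 := by
    rw [hζ, ← (stdAddChar (N := N)).map_zero_eq_one, injective_stdAddChar.ne_iff, Ne,
      ZMod.natCast_eq_zero_iff]
    intro h
    have := Nat.le_of_dvd hd0 h
    rw [hN] at this
    nlinarith
  have hζn : ζ ^ n = 1 := by
    rw [← hζj, mul_comm d n, ← hN]; simp
  have hgeom : ∑ j ∈ Finset.range n, ζ ^ j = 0 := by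
    have := mul_geom_sum ζ n
    rw [hζn, sub_self] at this
    exact (mul_eq_zero.1 this).resolve_left (sub_ne_zero.2 hζ1)
  have hζnorm : ‖ζ‖ = 1 := by rw [hζ]; exact AddChar.norm_apply _ _
  have hsum : ∑ x ∈ S, stdAddChar (Θ x) =
      ∑ j ∈ Finset.range n, ((S.filter fun x => φ x = j).card : ℂ) * ζ ^ j := by
    rw [← Finset.sum_fiberwise_of_maps_to hφ]
    refine Finset.sum_congr rfl fun j _ => ?_
    rw [← nsmul_eq_mul, ← Finset.sum_const]
    refine Finset.sum_congr rfl fun x hx => ?_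
    rw [Finset.mem_filter] at hx
    rw [hφΘ x hx.1, hx.2, hζj]
  have hsum2 : ∑ x ∈ S, stdAddChar (Θ x) =
      ∑ j ∈ Finset.range n, (((S.filter fun x => φ x = j).card : ℂ) - B0) * ζ ^ j := by
    simp only [sub_mul, Finset.sum_sub_distrib, ← Finset.mul_sum, hgeom, mul_zero, sub_zero]
    exact hsum
  have hcs : ∑ j ∈ Finset.range n, ((S.filter fun x => φ x = j).card : ℝ) = S.card := by
    rw [Finset.card_eq_sum_card_fiberwise hφ]; push_cast; rfl
  calc ‖∑ x ∈ S, stdAddChar (Θ x)‖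
      ≤ ∑ j ∈ Finset.range n, ‖(((S.filter fun x => φ x = j).card : ℂ) - B0) * ζ ^ j‖ := by
        rw [hsum2]; exact norm_sum_le _ _
    _ = ∑ j ∈ Finset.range n, (B0 - ((S.filter fun x => φ x = j).card : ℝ)) := by
        refine Finset.sum_congr rfl fun j _ => ?_
        rw [norm_mul, norm_pow, hζnorm, one_pow, mul_one]
        have : (((S.filter fun x => φ x = j).card : ℂ) - B0) =
          ((((S.filter fun x => φ x = j).card : ℝ) - B0 : ℝ) : ℂ) := by push_cast; rfl
        rw [this, Complex.norm_real, Real.norm_eq_abs, abs_of_nonpos (sub_nonpos.2 (hcard j))]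
        ring
    _ = n * B0 - S.card := by
        rw [Finset.sum_sub_distrib, hcs]; simp

theorem order_cases (p1 m N N' : ℕ) (hp1 : p1.Prime) (hp1o : Odd p1) (hN' : N' = p1 ^ m)
    (hN : N = 2 * N') (α : Fin 3 → ZMod N) (hα : α ≠ 0) :
    ∃ i0 n, 1 < n ∧ n ∣ N ∧ (∀ j, n • α j = 0) ∧ (addOrderOf (α i0) = n ∨
      ∃ n1, n = 2 * n1 ∧ Odd n1 ∧ addOrderOf (α i0) = n1 ∧ ∃ i, N' • α i ≠ 0) := by
  have hN'0 : 0 < N' := by rw [hN']; exact pow_pos hp1.pos _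
  have : NeZero N := ⟨by omega⟩
  have hNo : Odd N' := by rw [hN']; exact hp1o.pow
  have hNα : ∀ i, N • α i = 0 := by intro i; simp
  have hg : ∀ i, ∃ e ≤ m, addOrderOf (2 • α i) = p1 ^ e := by
    intro i
    rw [← Nat.dvd_prime_pow hp1, ← hN', addOrderOf_dvd_iff_nsmul_eq_zero, smul_smul, mul_comm N' 2,
      ← hN]
    exact hNα i
  choose e he1 he2 using hg
  obtain ⟨i0, hi0⟩ := Finite.exists_max e
  have hann : ∀ j, (2 * addOrderOf (2 • α i0)) • α j = 0 := by
    intro j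
    rw [mul_comm, ← smul_smul, ← addOrderOf_dvd_iff_nsmul_eq_zero, he2, he2]
    exact pow_dvd_pow _ (hi0 j)
  have hodd : ∀ i, N' • α i = 0 → Odd (addOrderOf (α i)) ∧ addOrderOf (2 • α i) = addOrderOf (α i) := by
    intro i hi
    have h1 : Odd (addOrderOf (α i)) :=
      Odd.of_dvd_nat hNo (addOrderOf_dvd_iff_nsmul_eq_zero.2 hi)
    refine ⟨h1, ?_⟩
    rw [Nat.Coprime.addOrderOf_nsmul]
    exact Nat.coprime_comm.1 (Nat.coprime_two_left.2 h1)
  have hdvN : ∀ i, addOrderOf (α i) ∣ N := fun i => addOrderOf_dvd_iff_nsmul_eq_zero.2 (hNα i)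
  by_cases hA : ∀ j, N' • α j = 0
  · refine ⟨i0, addOrderOf (α i0), ?_, hdvN _, ?_, Or.inl rfl⟩
    · have hpos : 0 < addOrderOf (α i0) := addOrderOf_pos _
      by_contra hlt
      have h1 : addOrderOf (α i0) = 1 := by omega
      apply hα
      funext j
      have h2 : addOrderOf (α j) ∣ addOrderOf (α i0) := by
        rw [← (hodd j (hA j)).2, ← (hodd i0 (hA i0)).2, he2, he2]
        exact pow_dvd_pow _ (hi0 j)
      rw [h1, Nat.dvd_one, AddMonoid.addOrderOf_eq_one_iff] at h2
      exact h2
    · intro j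
      rw [← addOrderOf_dvd_iff_nsmul_eq_zero, ← (hodd j (hA j)).2, ← (hodd i0 (hA i0)).2, he2, he2]
      exact pow_dvd_pow _ (hi0 j)
  · by_cases hB : N' • α i0 = 0
    · obtain ⟨h1, h2⟩ := hodd i0 hB
      refine ⟨i0, 2 * addOrderOf (α i0), ?_, ?_, ?_, Or.inr ⟨_, rfl, h1, rfl, ?_⟩⟩
      · have hpos : 0 < addOrderOf (α i0) := addOrderOf_pos _
        omega
      · exact (Nat.mul_dvd_mul_left 2 (addOrderOf_dvd_iff_nsmul_eq_zero.2 hB)).trans hN.symm.dvd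
      · rw [← h2]; exact hann
      · push Not at hA; exact hA
    · have hev : 2 ∣ addOrderOf (α i0) := by
        by_contra h
        have h1 : Nat.Coprime (addOrderOf (α i0)) 2 :=
          Nat.coprime_comm.1 ((Nat.Prime.coprime_iff_not_dvd Nat.prime_two).2 h)
        have h2 := (hdvN i0).trans hN.dvd
        exact hB (addOrderOf_dvd_iff_nsmul_eq_zero.1 (h1.dvd_of_dvd_mul_left h2))
      refine ⟨i0, addOrderOf (α i0), ?_, hdvN _, ?_, Or.inl rfl⟩
      · exact Nat.lt_of_lt_of_le one_lt_two (Nat.le_of_dvd (addOrderOf_pos _) hev)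
      · have h3 : addOrderOf (2 • α i0) = addOrderOf (α i0) / 2 := by
          rw [addOrderOf_nsmul, Nat.gcd_eq_right hev]
        rw [h3, Nat.mul_div_cancel' hev] at hann
        exact hann

theorem numerics (N q c n d : ℕ) (hN14 : 14 ≤ N) (hn : 1 < n) (hN : N = n * d)
    (hq : q = N * c + 1) (hbig : 16 * N ^ 6 ≤ q) :
    ∃ J M : ℕ, 2 ≤ J ∧ J ≤ c * d ∧ M ≤ q ∧ M * (c * d + M) < n * (J * (c * d - J)) ∧
      ∃ B0 : ℝ, n * B0 - (q - 3) ≤ 7 * N * Real.sqrt q ∧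
        ∀ z : ℕ, M * z + q ≤ (c * d - J) + 5 * (N * c) + q * J → (z : ℝ) ≤ B0 := by
  obtain ⟨s, hs⟩ : ∃ s, s = Nat.sqrt q := ⟨_, rfl⟩
  have hs1 : s * s ≤ q := by rw [hs]; exact Nat.sqrt_le q
  have hs2 : Real.sqrt q < s + 1 := by rw [hs]; exact Real.real_sqrt_lt_nat_sqrt_succ
  have hs3 : 4 * N ^ 3 ≤ s := by
    rw [hs, Nat.le_sqrt]; calc _ = 16 * N ^ 6 := by ring
      _ ≤ q := hbig
  have hN3 : 784 * N ≤ s := by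
    refine le_trans ?_ hs3
    have : 14 * 14 ≤ N * N := Nat.mul_le_mul hN14 hN14
    calc 784 * N = 4 * (14 * 14) * N := by ring
      _ ≤ 4 * (N * N) * N := by gcongr
      _ = _ := by ring
  have hd0 : 0 < d := by
    rcases Nat.eq_zero_or_pos d with h | h
    · rw [h] at hN; omega
    · exact h
  have hnN : n ≤ N := by rw [hN]; exact Nat.le_mul_of_pos_right _ hd0
  obtain ⟨E, hE⟩ : ∃ E, E = c * d := ⟨_, rfl⟩
  have hnE : n * E + 1 = q := by rw [hE, hq, hN]; ring
  obtain ⟨J, hJ⟩ : ∃ J, J = s / n := ⟨_, rfl⟩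
  have ha1 : n * J ≤ s := by rw [hJ]; exact Nat.mul_div_le s n
  have ha2 : s < n * J + n := by
    have := Nat.lt_mul_div_succ s (show 0 < n by omega)
    rw [hJ]; linarith
  have hJ2 : 2 ≤ J := by
    rw [hJ, Nat.le_div_iff_mul_le (by omega)]; omega
  have hsq : s + 1 ≤ q := by nlinarith
  have hJE : J ≤ E := by
    have : n * J ≤ n * E := by omega
    exact Nat.le_of_mul_le_mul_left this (by omega)
  obtain ⟨M, hM⟩ : ∃ M, M + (n + 2) = n * J := ⟨n * J - (n + 2), by omega⟩
  have hMs : M ≤ s := by omega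
  rw [← hE]
  refine ⟨J, M, hJ2, hJE, by omega, ?_, ?_⟩
  · obtain ⟨G, hG⟩ := Nat.exists_eq_add_of_le hJE
    have hG' : E - J = G := by omega
    rw [hG']
    have hkey : n * (M * (E + M)) < n * (n * (J * G)) := by
      have h1 : n * (n * (J * G)) + (n * J) * (n * J) = (n * J) * (n * E) := by rw [hG]; ring
      have h2 : n * (M * (E + M)) + (n + 2) * (n * E) = (n * J) * (n * E) + n * (M * M) := by
        rw [← hM]; ring
      have h3 : (n * J) * (n * J) ≤ q := le_trans (Nat.mul_le_mul ha1 ha1) hs1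
      have h4 : M * M ≤ q := le_trans (Nat.mul_le_mul hMs hMs) hs1
      have h5 : n * (M * M) ≤ n * q := Nat.mul_le_mul_left _ h4
      have h6 : (n + 2) * (n * E) + (n + 2) = n * q + 2 * q := by rw [← hnE]; ring
      have h7 : n + 2 < q := by omega
      linarith
    exact Nat.lt_of_mul_lt_mul_left hkey
  · have hMR : (M : ℝ) + (n + 2) = n * J := by exact_mod_cast hM
    have hnR : (2 : ℝ) ≤ n := by exact_mod_cast hn
    have hnNR : (n : ℝ) ≤ N := by exact_mod_cast hnN
    have hNR : (14 : ℝ) ≤ N := by exact_mod_cast hN14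
    obtain ⟨r, hr⟩ : ∃ r, r = Real.sqrt q := ⟨_, rfl⟩
    have hrr : r * r = q := by rw [hr]; exact Real.mul_self_sqrt (Nat.cast_nonneg _)
    rw [← hr] at hs2 ⊢
    have hsr : (s : ℝ) ≤ r := by rw [hs, hr]; exact Real.nat_sqrt_le_real_sqrt
    have hNr : (784 : ℝ) * N ≤ r := le_trans (by exact_mod_cast hN3) hsr
    have ha2R : (s : ℝ) + 1 ≤ n * J + n := by exact_mod_cast ha2
    have hMbig : 99 / 100 * r ≤ M := by linarith
    have hMpos : (0 : ℝ) < M := by linarith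
    refine ⟨(q + q * (5 * n + 3) / M) / n, ?_, ?_⟩
    · rw [mul_div_cancel₀ _ (by positivity)]
      have : (q : ℝ) * (5 * n + 3) / M ≤ 7 * N * r - 3 := by
        rw [div_le_iff₀ hMpos]
        have h1 : (7 * N * r - 3) * (99 / 100 * r) ≤ (7 * N * r - 3) * M :=
          mul_le_mul_of_nonneg_left hMbig (by nlinarith)
        refine le_trans ?_ h1
        rw [← hrr]
        have h2 : r * (5 * n + 3) ≤ (7 * N * r - 3) * (99 / 100) := by nlinarith
        have h3 : 0 ≤ r := by linarith
        nlinarith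
      linarith
    · intro z hz
      have hz2 : (M : ℝ) * z + q ≤ E + 5 * (q - 1) + q * J := by
        have h1 : M * z + q + 5 ≤ E + 5 * q + q * J := by
          have : N * c + 1 = q := hq.symm
          omega
        have : ((M * z + q + 5 : ℕ) : ℝ) ≤ ((E + 5 * q + q * J : ℕ) : ℝ) := by exact_mod_cast h1
        push_cast at this
        linarith
      have hnER : (n : ℝ) * E + 1 = q := by exact_mod_cast hnE
      have h1 : (q : ℝ) + q * (5 * n + 3) / M = (q * M + q * (5 * n + 3)) / M := by
        field_simp
      rw [le_div_iff₀ (by positivity), h1, le_div_iff₀ hMpos]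
      have h2 := mul_le_mul_of_nonneg_left hz2 (show (0 : ℝ) ≤ n by positivity)
      have h3 : (q : ℝ) * (M + (n + 2)) = q * (n * J) := by rw [hMR]
      linarith

theorem S_bound {F : Type*} [Field F] [DecidableEq F] (p e q : ℕ) [Fact p.Prime] [CharP F p]
    (hqp : q = p ^ e) (hF : ∀ x : F, x ^ q = x) (p1 m N N' c : ℕ) [NeZero N]
    (hp1 : p1.Prime) (hp1o : Odd p1) (hN' : N' = p1 ^ m) (hN : N = 2 * N') (hN14 : 14 ≤ N)
    (hbig : 16 * N ^ 6 ≤ q) (hq : q = N * c + 1)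
    (pt : Fin 3 → F) (hpt : Function.Injective pt)
    (α : Fin 3 → ZMod N) (hα : α ≠ 0) (ω : F) (hω : ω ^ (N * c) = 1)
    (cl : F → ℕ) (hcl : ∀ x : F, x ≠ 0 → ω ^ cl x = x) (S : Finset F)
    (hS : ∀ x ∈ S, ∀ i, x ≠ pt i) (hScard : q ≤ S.card + 3) :
    ‖∑ x ∈ S, ZMod.stdAddChar (∑ i, α i * (cl (x - pt i) : ZMod N))‖ ≤ 7 * N * Real.sqrt q := by
  obtain ⟨i0, n, hn, ⟨d, hd⟩, hann, hcase⟩ := order_cases p1 m N N' hp1 hp1o hN' hN α hα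
  obtain ⟨J, M, hJ2, hJE, hMq, hcount, B0, hB0, hz⟩ := numerics N q c n d hN14 hn hd hq hbig
  have hc : 0 < c := by
    rcases Nat.eq_zero_or_pos c with h | h
    · rw [h] at hJE; omega
    · exact h
  refine le_trans (char_sum_bound N n d hd hn S
    (fun x => ∑ i, α i * (cl (x - pt i) : ZMod N)) ?_ B0 ?_) ?_
  · intro x _
    rw [Finset.smul_sum]
    refine Finset.sum_eq_zero fun i _ => ?_
    rw [← smul_mul_assoc, hann, zero_mul]
  · intro θ
    apply hz
    rcases hcase with h | ⟨n1, hn1, hodd, hord, hex⟩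
    · refine fiber_full p e q hqp hF N c n d J M hq hd hJE hJ2 pt hpt i0 α h ω hω cl hcl θ _ ?_
        hMq hcount
      intro x hx
      rw [Finset.mem_filter] at hx
      exact ⟨hS x hx.1, hx.2⟩
    · refine fiber_mixed p e q hqp hF N N' c n1 d J M hc hq hN (by rw [← hn1]; exact hd) hJE hJ2
        pt hpt i0 α hord hodd hex ω hω cl hcl θ _ ?_ hMq (by rw [← hn1]; exact hcount)
      intro x hx
      rw [Finset.mem_filter] at hx
      exact ⟨hS x hx.1, hx.2⟩
  · refine le_trans ?_ hB0
    have : (q : ℝ) ≤ S.card + 3 := by exact_mod_cast hScard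
    linarith

open ZMod in
theorem fourier_ind (N : ℕ) [NeZero N] (B : Finset (ZMod N)) :
    ∃ c : ZMod N → ℂ, (∀ z, (if z ∈ B then (1 : ℂ) else 0) = ∑ k, c k * stdAddChar (k * z)) ∧
      ∑ k, ‖c k‖ ≤ Real.sqrt N := by
  classical
  have hN0 : (N : ℂ) ≠ 0 := by exact_mod_cast NeZero.ne N
  have hNR : (0 : ℝ) < N := by exact_mod_cast Nat.pos_of_ne_zero (NeZero.ne N)
  have horth : ∀ b : ZMod N, ∑ k : ZMod N, (stdAddChar (k * b) : ℂ) = if b = 0 then (N : ℂ) else 0 := by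
    intro b
    rw [AddChar.sum_mulShift b (isPrimitive_stdAddChar N), ZMod.card]
    split_ifs <;> simp
  refine ⟨fun k => (N : ℂ)⁻¹ * ∑ w ∈ B, stdAddChar (-(k * w)), ?_, ?_⟩
  · intro z
    have : ∀ k : ZMod N, ((N : ℂ)⁻¹ * ∑ w ∈ B, stdAddChar (-(k * w))) * stdAddChar (k * z)
        = (N : ℂ)⁻¹ * ∑ w ∈ B, stdAddChar (k * (z - w)) := by
      intro k
      rw [mul_assoc, Finset.sum_mul]
      congr 1
      refine Finset.sum_congr rfl fun w _ => ?_
      rw [← AddChar.map_add_eq_mul]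
      congr 1; ring
    simp only [this]
    rw [← Finset.mul_sum, Finset.sum_comm]
    simp only [horth, sub_eq_zero]
    rw [Finset.sum_ite_eq B z]
    split_ifs <;> simp [hN0]
  · have hpars : ∑ k : ZMod N, ‖(N : ℂ)⁻¹ * ∑ w ∈ B, stdAddChar (-(k * w))‖ ^ 2 ≤ 1 := by
      have h1 : ((∑ k : ZMod N, ‖(N : ℂ)⁻¹ * ∑ w ∈ B, stdAddChar (-(k * w))‖ ^ 2 : ℝ) : ℂ)
          = ((B.card / N : ℝ) : ℂ) := by
        push_cast
        have h2 : ∀ k : ZMod N, ((‖(N : ℂ)⁻¹ * ∑ w ∈ B, stdAddChar (-(k * w))‖ : ℝ) : ℂ) ^ 2 =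
            (N : ℂ)⁻¹ * (N : ℂ)⁻¹ * ∑ w ∈ B, ∑ v ∈ B, stdAddChar (k * (v - w)) := by
          intro k
          rw [← Complex.mul_conj']
          simp only [map_mul, map_sum, map_inv₀, Complex.conj_natCast]
          rw [mul_mul_mul_comm, Finset.sum_mul_sum]
          congr 1
          refine Finset.sum_congr rfl fun w _ => Finset.sum_congr rfl fun v _ => ?_
          rw [← AddChar.map_neg_eq_conj, ← AddChar.map_add_eq_mul]
          congr 1; ring
        simp only [h2]
        rw [← Finset.mul_sum, Finset.sum_comm]
        have h3 : ∀ w ∈ B, ∑ k : ZMod N, ∑ v ∈ B, (stdAddChar (k * (v - w)) : ℂ) = N := by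
          intro w hw
          rw [Finset.sum_comm]
          simp only [horth, sub_eq_zero]
          rw [Finset.sum_ite_eq' B w, if_pos hw]
        rw [Finset.sum_congr rfl h3, Finset.sum_const, nsmul_eq_mul]
        field_simp
      have h4 := Complex.ofReal_injective h1
      rw [h4, div_le_one hNR]
      have := Finset.card_le_univ B
      rw [ZMod.card] at this
      exact_mod_cast this
    apply Real.le_sqrt_of_sq_le
    refine le_trans sq_sum_le_card_mul_sum_sq ?_
    rw [Finset.card_univ, ZMod.card]
    nlinarith

open ZMod in
theorem T_diff {F : Type*} [Field F] [DecidableEq F] (N : ℕ) [NeZero N] (pt : Fin 3 → F)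
    (cl : F → ℕ) (S : Finset F) (R : ℝ)
    (hR : ∀ α : Fin 3 → ZMod N, α ≠ 0 →
      ‖∑ x ∈ S, stdAddChar (∑ i, α i * (cl (x - pt i) : ZMod N))‖ ≤ R) (hR0 : 0 ≤ R)
    (B : Finset (ZMod N)) (T : ZMod N → ℕ)
    (hT : ∀ l, T l = (S.filter fun x => ∀ i, (cl (x - pt i) : ZMod N) + l ∈ B).card)
    (l l' : ZMod N) : |(T l : ℝ) - T l'| ≤ Real.sqrt N ^ 3 * (2 * R) := by
  obtain ⟨c, hc, hcn⟩ := fourier_ind N B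
  have hexp : ∀ l, (T l : ℂ) = ∑ k : Fin 3 → ZMod N, (∏ i, c (k i)) * stdAddChar (l * ∑ i, k i) *
      ∑ x ∈ S, stdAddChar (∑ i, k i * (cl (x - pt i) : ZMod N)) := by
    intro l
    have h1 : (T l : ℂ) = ∑ x ∈ S, ∏ i : Fin 3,
        (if (cl (x - pt i) : ZMod N) + l ∈ B then (1 : ℂ) else 0) := by
      rw [hT, Finset.card_filter]
      push_cast
      refine Finset.sum_congr rfl fun x _ => ?_
      rw [Finset.prod_ite_zero]
      simp
    rw [h1]
    simp only [hc]
    simp only [Finset.prod_univ_sum, Fintype.piFinset_univ, Finset.mul_sum]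
    rw [Finset.sum_comm]
    refine Finset.sum_congr rfl fun k _ => Finset.sum_congr rfl fun x _ => ?_
    rw [Finset.prod_mul_distrib, mul_assoc, ← AddChar.map_add_eq_mul]
    have h2 : ∏ i, (stdAddChar (k i * ((cl (x - pt i) : ZMod N) + l)) : ℂ) =
        stdAddChar (∑ i, k i * ((cl (x - pt i) : ZMod N) + l)) := by
      simp only [Fin.prod_univ_three, Fin.sum_univ_three, AddChar.map_add_eq_mul]
    rw [h2]
    congr 2
    rw [← Finset.sum_add_distrib]
    refine Finset.sum_congr rfl fun i _ => ?_
    ring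
  have hdiff : ((((T l : ℝ) - T l' : ℝ)) : ℂ) = ∑ k : Fin 3 → ZMod N, (∏ i, c (k i)) *
      ((stdAddChar (l * ∑ i, k i) - stdAddChar (l' * ∑ i, k i)) *
      ∑ x ∈ S, stdAddChar (∑ i, k i * (cl (x - pt i) : ZMod N))) := by
    push_cast
    rw [hexp, hexp, ← Finset.sum_sub_distrib]
    refine Finset.sum_congr rfl fun k _ => ?_
    ring
  rw [← Real.norm_eq_abs, ← Complex.norm_real, hdiff]
  calc _ ≤ ∑ k : Fin 3 → ZMod N, ‖(∏ i, c (k i)) *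
      ((stdAddChar (l * ∑ i, k i) - stdAddChar (l' * ∑ i, k i)) *
      ∑ x ∈ S, stdAddChar (∑ i, k i * (cl (x - pt i) : ZMod N)))‖ := norm_sum_le _ _
    _ ≤ ∑ k : Fin 3 → ZMod N, (∏ i, ‖c (k i)‖) * (2 * R) := by
      refine Finset.sum_le_sum fun k _ => ?_
      rw [norm_mul, norm_prod]
      refine mul_le_mul_of_nonneg_left ?_ (Finset.prod_nonneg fun _ _ => norm_nonneg _)
      by_cases hk : k = 0
      · subst hk
        simp [hR0]
      · rw [norm_mul]
        refine mul_le_mul ?_ (hR k hk) (norm_nonneg _) (by norm_num)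
        refine le_trans (norm_sub_le _ _) ?_
        rw [AddChar.norm_apply, AddChar.norm_apply]
        norm_num
    _ = (∑ k, ‖c k‖) ^ 3 * (2 * R) := by
      have h3 := Finset.prod_univ_sum (fun _ : Fin 3 => (Finset.univ : Finset (ZMod N)))
        (fun _ k => ‖c k‖)
      rw [Fintype.piFinset_univ] at h3
      rw [← Finset.sum_mul, ← h3]
      simp
    _ ≤ _ := by gcongr

theorem exists_log {F : Type*} [Field F] [Fintype F] (g : F)
    (hg : orderOf g = Fintype.card F - 1) (x : F) (hx : x ≠ 0) : ∃ n : ℕ, g ^ n = x := by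
  have h2 : 1 < Fintype.card F := Fintype.one_lt_card
  have hg0 : g ≠ 0 := by
    rintro rfl
    have := pow_orderOf_eq_one (0 : F)
    rw [zero_pow (by omega)] at this
    exact zero_ne_one this
  have h1 : Nat.card (Subgroup.zpowers (Units.mk0 g hg0)) = Nat.card Fˣ := by
    classical
    rw [Nat.card_zpowers, ← orderOf_units, Units.val_mk0, hg, Nat.card_eq_fintype_card,
      Fintype.card_units]
  have h3 := Subgroup.eq_top_of_card_eq _ h1
  have h4 : Units.mk0 x hx ∈ Subgroup.zpowers (Units.mk0 g hg0) := by rw [h3]; trivial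
  rw [← mem_powers_iff_mem_zpowers] at h4
  obtain ⟨n, hn⟩ := h4
  refine ⟨n, ?_⟩
  have := congrArg Units.val hn
  simpa using this

theorem mem_D_iff {F : Type*} [Field F] (N c tinv : ℕ) (hc : 0 < c) (hN0 : 0 < N)
    (ω : F) (hω : orderOf ω = N * c) (I : Finset ℕ) (n : ℕ) :
    (∃ i ∈ I, ∃ j : ℕ, ω ^ n = ω ^ (tinv * i + N * j)) ↔
      (n : ZMod N) ∈ I.image (fun i => ((tinv * i : ℕ) : ZMod N)) := by
  classical
  have hpos : 0 < orderOf ω := by rw [hω]; positivity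
  have hfin : IsOfFinOrder ω := orderOf_pos_iff.1 hpos
  rw [Finset.mem_image]
  constructor
  · rintro ⟨i, hi, j, h⟩
    refine ⟨i, hi, ?_⟩
    rw [hfin.pow_eq_pow_iff_modEq, hω] at h
    have h2 := h.of_mul_right c
    have h3 := (ZMod.natCast_eq_natCast_iff _ _ _).2 h2
    rw [h3]; push_cast; simp
  · rintro ⟨i, hi, h⟩
    refine ⟨i, hi, ?_⟩
    rw [ZMod.natCast_eq_natCast_iff] at h
    have h1 : tinv * i ≡ n + N * (c * (tinv * i)) [MOD N] := by
      refine h.trans ?_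
      simp [Nat.ModEq]
    have hle : tinv * i ≤ n + N * (c * (tinv * i)) := by
      have : 1 * (tinv * i) ≤ N * c * (tinv * i) := Nat.mul_le_mul_right _ (by rw [← hω]; omega)
      rw [← mul_assoc]; omega
    obtain ⟨j, hj⟩ := (Nat.modEq_iff_dvd' hle).1 h1
    refine ⟨j, ?_⟩
    have : tinv * i + N * j = n + N * (c * (tinv * i)) := by omega
    rw [this, pow_add, ← mul_assoc, pow_mul, ← hω, pow_orderOf_eq_one, one_pow, mul_one]

theorem F_side {F : Type*} [Field F] [Fintype F] (p e q : ℕ) [Fact p.Prime] [CharP F p]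
    (hqp : q = p ^ e) (hcard : Fintype.card F = q) (p1 m N N' c : ℕ) [NeZero N]
    (hp1 : p1.Prime) (hp1o : Odd p1) (hN' : N' = p1 ^ m) (hN : N = 2 * N') (hN14 : 14 ≤ N)
    (hbig : 16 * N ^ 6 ≤ q) (hq : q = N * c + 1)
    (ω : F) (hω : orderOf ω = q - 1) (tinv : ℕ) (I : Finset ℕ)
    (a : F) (ha0 : a ≠ 0) (ha1 : a ≠ 1) (D : Set F)
    (hD : D = {x : F | ∃ i ∈ I, ∃ j : ℕ, x = ω ^ (tinv * i + N * j)}) (l l' : ℕ) :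
    |(tripleInt (ω ^ l) a D : ℝ) - tripleInt (ω ^ l') a D| ≤
      Real.sqrt N ^ 3 * (2 * (7 * N * Real.sqrt q)) := by
  classical
  have hF : ∀ x : F, x ^ q = x := by intro x; rw [← hcard]; exact FiniteField.pow_card x
  have hN0 : 0 < N := by omega
  have hc : 0 < c := by
    rcases Nat.eq_zero_or_pos c with h | h
    · rw [h] at hq
      have : 0 < N ^ 6 := by positivity
      omega
    · exact h
  have hω' : orderOf ω = N * c := by omega
  have hω1 : ω ^ (N * c) = 1 := by rw [← hω']; exact pow_orderOf_eq_one _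
  have hω0 : ω ≠ 0 := by
    rintro rfl
    rw [zero_pow (by positivity)] at hω1
    exact zero_ne_one hω1
  have hlog : ∀ x : F, ∃ n : ℕ, x ≠ 0 → ω ^ n = x := by
    intro x
    by_cases hx : x = 0
    · exact ⟨0, fun h => absurd hx h⟩
    · obtain ⟨n, hn⟩ := exists_log ω (by rw [hω, hcard]) x hx
      exact ⟨n, fun _ => hn⟩
  choose cl hcl using hlog
  obtain ⟨B, hB⟩ : ∃ B, B = I.image (fun i => ((tinv * i : ℕ) : ZMod N)) := ⟨_, rfl⟩
  obtain ⟨pt, hptd⟩ : ∃ pt : Fin 3 → F, pt = ![0, -1, -a] := ⟨_, rfl⟩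
  have hpt : Function.Injective pt := by
    rw [hptd]
    intro i j hij
    fin_cases i <;> fin_cases j <;> simp_all
  obtain ⟨S, hS⟩ : ∃ S : Finset F, S = Finset.univ \ Finset.univ.image pt := ⟨_, rfl⟩
  have hS1 : ∀ x ∈ S, ∀ i, x ≠ pt i := by
    intro x hx i h
    rw [hS] at hx
    simp at hx
    exact hx i h.symm
  have hS2 : q ≤ S.card + 3 := by
    have h1 := Finset.card_sdiff_add_card_eq_card (Finset.subset_univ (Finset.univ.image pt))
    rw [← hS, Finset.card_univ, hcard, Finset.card_image_of_injective _ hpt] at h1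
    simp at h1
    omega
  have hmem : ∀ (n : ℕ) (z : F), ω ^ n * z ∈ D ↔ z ≠ 0 ∧ (cl z : ZMod N) + n ∈ B := by
    intro n z
    by_cases hz : z = 0
    · subst hz
      simp only [mul_zero, ne_eq, not_true_eq_false, false_and, iff_false]
      rw [hD]
      rintro ⟨i, _, j, h⟩
      exact pow_ne_zero _ hω0 h.symm
    · have h1 : ω ^ n * z = ω ^ (cl z + n) := by rw [pow_add, hcl z hz, mul_comm]
      rw [h1, hD, hB]
      simp only [ne_eq, hz, not_false_eq_true, true_and]
      have := mem_D_iff N c tinv hc hN0 ω hω' I (cl z + n)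
      rw [Nat.cast_add] at this
      exact this
  have hT : ∀ n : ℕ, tripleInt (ω ^ n) a D =
      (S.filter fun x => ∀ i, (cl (x - pt i) : ZMod N) + n ∈ B).card := by
    intro n
    rw [tripleInt, ← Set.ncard_coe_finset]
    symm
    refine Set.ncard_congr (fun y _ => ω ^ n * y) ?_ ?_ ?_
    · intro y hy
      have hy' := Finset.mem_filter.1 (Finset.mem_coe.1 hy)
      have h0 : ∀ i, ω ^ n * (y - pt i) ∈ D := fun i =>
        (hmem n _).2 ⟨sub_ne_zero.2 (hS1 y hy'.1 i), hy'.2 i⟩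
      have e0 := h0 0
      have e1 := h0 1
      have e2 := h0 2
      simp [hptd] at e0 e1 e2
      refine ⟨e0, ?_, ?_⟩
      · convert e1 using 1; ring
      · convert e2 using 1; ring
    · intro x y _ _ h
      exact mul_left_cancel₀ (pow_ne_zero _ hω0) h
    · rintro x ⟨e0, e1, e2⟩
      refine ⟨(ω ^ n)⁻¹ * x, ?_, ?_⟩
      · have hx : x = ω ^ n * ((ω ^ n)⁻¹ * x) := by
          rw [mul_inv_cancel_left₀ (pow_ne_zero _ hω0)]
        generalize (ω ^ n)⁻¹ * x = y at hx
        have h0 : ∀ i, ω ^ n * (y - pt i) ∈ D := by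
          intro i
          rw [hptd]
          fin_cases i
          · simpa [← hx] using e0
          · have : ω ^ n * (y - -1) = x + ω ^ n := by rw [hx]; ring
            change ω ^ n * (y - -1) ∈ D
            rwa [this]
          · have : ω ^ n * (y - -a) = x + a * ω ^ n := by rw [hx]; ring
            change ω ^ n * (y - -a) ∈ D
            rwa [this]
        rw [Finset.mem_coe, Finset.mem_filter]
        refine ⟨?_, fun i => ((hmem n _).1 (h0 i)).2⟩
        rw [hS]
        simp only [Finset.mem_sdiff, Finset.mem_univ, Finset.mem_image, true_and, not_exists]
        intro i h
        exact ((hmem n _).1 (h0 i)).1 (by rw [h, sub_self])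
      · exact mul_inv_cancel_left₀ (pow_ne_zero _ hω0) x
  rw [hT, hT]
  exact T_diff N pt cl S (7 * N * Real.sqrt q)
    (fun α hα => S_bound p e q hqp hF p1 m N N' c hp1 hp1o hN' hN hN14 hbig hq pt hpt α hα ω hω1 cl
      hcl S hS1 hS2) (by positivity) B
    (fun l => (S.filter fun x => ∀ i, (cl (x - pt i) : ZMod N) + l ∈ B).card) (fun _ => rfl) l l'

theorem tripleInt_smul {K : Type*} [Field K] (c β a : K) (hc : c ≠ 0) (D : Set K)
    (hD : ∀ x, c * x ∈ D ↔ x ∈ D) : tripleInt (c * β) a D = tripleInt β a D := by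
  unfold tripleInt
  symm
  refine Set.ncard_congr (fun y _ => c * y) ?_ ?_ ?_
  · rintro y ⟨h0, h1, h2⟩
    refine ⟨(hD _).2 h0, ?_, ?_⟩
    · have : c * y + c * β = c * (y + β) := by ring
      rw [this]; exact (hD _).2 h1
    · have : c * y + a * (c * β) = c * (y + a * β) := by ring
      rw [this]; exact (hD _).2 h2
  · intro x y _ _ h
    exact mul_left_cancel₀ hc h
  · rintro x ⟨h0, h1, h2⟩
    have hx : c * (c⁻¹ * x) = x := mul_inv_cancel_left₀ hc x
    refine ⟨c⁻¹ * x, ⟨(hD _).1 (by rwa [hx]), (hD _).1 ?_, (hD _).1 ?_⟩, hx⟩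
    · rw [mul_add, hx]; exact h1
    · have : c * (c⁻¹ * x + a * β) = x + a * (c * β) := by rw [mul_add, hx]; ring
      rw [this]; exact h2

theorem tripleInt_modEq {K : Type*} [Field K] [Fintype K] (q t : ℕ) (ht : t.Prime)
    (φ : K →+* K) (hφ : ∀ x, φ x = x ^ q) (hK : Fintype.card K = q ^ t) (β a : K) (hβ : β ^ q = β)
    (ha : a ^ q = a) (D E : Set K) (hD : ∀ x ∈ D, x ^ q ∈ D) (hE : ∀ x, x ∈ E ↔ x ∈ D ∧ x ^ q = x) :
    tripleInt β a D ≡ tripleInt β a E [MOD t] := by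
  classical
  have : Fact t.Prime := ⟨ht⟩
  obtain ⟨X, hX⟩ : ∃ X : Set K, X = {x : K | x ∈ D ∧ x + β ∈ D ∧ x + a * β ∈ D} := ⟨_, rfl⟩
  have hadd : ∀ x y : K, (x + y) ^ q = x ^ q + y ^ q := by
    intro x y; rw [← hφ, ← hφ, ← hφ, map_add]
  have hab : (a * β) ^ q = a * β := by rw [mul_pow, ha, hβ]
  have hmaps : ∀ x ∈ X, x ^ q ∈ X := by
    intro x hx
    rw [hX] at hx ⊢
    obtain ⟨h0, h1, h2⟩ := hx
    refine ⟨hD _ h0, ?_, ?_⟩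
    · have := hD _ h1
      rwa [hadd, hβ] at this
    · have := hD _ h2
      rwa [hadd, hab] at this
  let g : Function.End X := fun x => ⟨(x : K) ^ q, hmaps x x.2⟩
  have hg : ∀ n : ℕ, ∀ x : X, ((g ^ n) x : K) = (x : K) ^ q ^ n := by
    intro n
    induction n with
    | zero => intro x; simp; rfl
    | succ n ih =>
      intro x
      rw [pow_succ]
      change ((g ^ n) (g x) : K) = _
      rw [ih]
      change ((x : K) ^ q) ^ q ^ n = _
      rw [← pow_mul, pow_succ, mul_comm]
  have hgt : g ^ t ^ 1 = 1 := by
    funext x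
    apply Subtype.ext
    rw [hg, pow_one, ← hK, FiniteField.pow_card]
    rfl
  have key := Equiv.Perm.card_fixedPoints_modEq hgt
  have h1 : Fintype.card X = tripleInt β a D := by
    rw [tripleInt, ← hX, ← Nat.card_eq_fintype_card, Nat.card_coe_set_eq]
  have h2 : Fintype.card (Function.fixedPoints g) = tripleInt β a E := by
    rw [tripleInt, ← Nat.card_eq_fintype_card, Nat.card_coe_set_eq]
    refine Set.ncard_congr (fun y _ => (y : K)) ?_ ?_ ?_
    · rintro ⟨y, hy⟩ hfix
      have hyq : y ^ q = y := congrArg Subtype.val hfix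
      rw [hX] at hy
      obtain ⟨h0, h1, h2⟩ := hy
      refine ⟨(hE _).2 ⟨h0, hyq⟩, (hE _).2 ⟨h1, ?_⟩, (hE _).2 ⟨h2, ?_⟩⟩
      · change (y + β) ^ q = y + β
        rw [hadd, hyq, hβ]
      · change (y + a * β) ^ q = y + a * β
        rw [hadd, hyq, hab]
    · intro x y _ _ h
      exact Subtype.ext h
    · rintro x ⟨h0, h1, h2⟩
      refine ⟨⟨x, ?_⟩, ?_, rfl⟩
      · rw [hX]
        exact ⟨((hE _).1 h0).1, ((hE _).1 h1).1, ((hE _).1 h2).1⟩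
      · exact Subtype.ext ((hE _).1 h0).2
  rw [h1, h2] at key
  exact key

theorem natcast_inj (t : ℕ) (x y : ℕ) (h : (x : ZMod t) = y) (hlt : |(x : ℝ) - y| < t) : x = y := by
  rw [ZMod.natCast_eq_natCast_iff] at h
  have h1 := Nat.modEq_iff_dvd.1 h
  have h2 : |(y : ℤ) - x| < t := by
    rw [abs_sub_comm] at hlt
    exact_mod_cast hlt
  have := Int.eq_zero_of_abs_lt_dvd h1 h2
  omega

theorem final_numeric (N : ℕ) (hN : 14 ≤ N) (r : ℝ) (hr : 0 ≤ r) :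
    Real.sqrt N ^ 3 * (2 * (7 * N * r)) ≤ 4 * N ^ 3 * r := by
  obtain ⟨v, hv⟩ : ∃ v, v = Real.sqrt N := ⟨_, rfl⟩
  have hvv : v * v = N := by rw [hv]; exact Real.mul_self_sqrt (Nat.cast_nonneg _)
  have hv1 : 7 / 2 ≤ v := by
    rw [hv]
    apply Real.le_sqrt_of_sq_le
    have : (14 : ℝ) ≤ N := by exact_mod_cast hN
    linarith
  rw [← hv, ← hvv]
  have h : 0 ≤ v ^ 5 * r * (4 * v - 14) := by
    have : 0 ≤ 4 * v - 14 := by linarith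
    positivity
  nlinarith

end Helpers

/-- Corollary 3.3: Feng–Xiang setting; `t` an odd prime with `t > 4N³√q`, `γ` a primitive
element of `𝔽_{q^t}`, `ω = γ^{(q^t-1)/(q-1)}`, `D' = ⋃_{i∈I} γ^i⟨γ^N⟩` the lift of the
Feng–Xiang skew Hadamard difference set `D`, and `tinv` the inverse of `t` mod `N`.
If `{T_{ω^ℓ,a}(D^{(t⁻¹)}) : 0 ≤ ℓ ≤ N-1} ⊆ ℤ` has exactly `u` elements, then
`{T_{γ^ℓ,a}(D') mod t : 0 ≤ ℓ ≤ N-1} ⊆ ℤ/tℤ` also has exactly `u` elements. -/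
theorem lift_tripleInt_large_prime_extension
    (p1 m N p f s q t tinv : ℕ)
    (hp1 : p1.Prime) (hp1mod : p1 % 8 = 7) (hm : 1 ≤ m) (hN : N = 2 * p1 ^ m)
    (hp : p.Prime) (hpmod : p % 4 = 3)
    (hf : f = N.totient / 2) (hord : orderOf (p : ZMod N) = f)
    (hs : Odd s) (hq : q = p ^ (f * s))
    (ht : t.Prime) (htodd : Odd t)
    (htbig : (4 : ℝ) * N ^ 3 * Real.sqrt q < t)
    (htinv : t * tinv ≡ 1 [MOD N])
    (I : Finset ℕ) (hIN : ∀ i ∈ I, i < N)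
    (hIcov : ∀ r : ZMod (p1 ^ m), ∃ i ∈ I, (i : ZMod (p1 ^ m)) = r)
    (K : Type*) [Field K] [Fintype K] (hK : Fintype.card K = q ^ t)
    (γ : K) (hγ : orderOf γ = q ^ t - 1)
    (ω : K) (hω : ω = γ ^ ((q ^ t - 1) / (q - 1)))
    (Dt : Set K) (hDt : Dt = {x : K | ∃ i ∈ I, ∃ j : ℕ, x = ω ^ (tinv * i + N * j)})
    (D' : Set K) (hD' : D' = {x : K | ∃ i ∈ I, ∃ j : ℕ, x = γ ^ (i + N * j)})
    (a : K) (ha0 : a ≠ 0) (ha1 : a ≠ 1) (hap : a ^ p = a)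
    (u : ℕ)
    (hu : ((Finset.range N).image (fun ℓ => tripleInt (ω ^ ℓ) a Dt)).card = u) :
    ((Finset.range N).image
        (fun ℓ => ((tripleInt (γ ^ ℓ) a D' : ℕ) : ZMod t))).card = u := by
  classical
  have hpF : Fact p.Prime := ⟨hp⟩
  have hp7 : 7 ≤ p1 := by omega
  have hp1o : Odd p1 := Nat.odd_iff.2 (by omega)
  have hN14 : 14 ≤ N := by
    have : p1 ≤ p1 ^ m := Nat.le_self_pow (by omega) _
    omega
  have hN0 : 0 < N := by omega
  have hNe : NeZero N := ⟨by omega⟩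
  have hf0 : 0 < f := by
    rcases Nat.eq_zero_or_pos f with h | h
    · exfalso
      have h1 : N.totient = 1 := by
        have := Nat.totient_pos.2 hN0
        omega
      rcases Nat.totient_eq_one_iff.1 h1 with h | h <;> omega
    · exact h
  have hs0 : 0 < s := hs.pos
  have hq3 : 3 ≤ q := by
    rw [hq]
    calc 3 ≤ p := by omega
      _ ≤ _ := Nat.le_self_pow (by positivity) _
  have hqN : (q : ZMod N) = 1 := by
    rw [hq, Nat.cast_pow, pow_mul, ← hord, pow_orderOf_eq_one, one_pow]
  obtain ⟨c, hc⟩ : ∃ c, q = N * c + 1 := by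
    have h1 : (1 : ℕ) ≡ q [MOD N] := by
      rw [← ZMod.natCast_eq_natCast_iff, hqN, Nat.cast_one]
    obtain ⟨c, hc⟩ := (Nat.modEq_iff_dvd' (by omega)).1 h1
    exact ⟨c, by omega⟩
  have hc0 : 0 < c := by
    rcases Nat.eq_zero_or_pos c with h | h
    · rw [h] at hc; omega
    · exact h
  obtain ⟨E, hE⟩ : ∃ E, E = (q ^ t - 1) / (q - 1) := ⟨_, rfl⟩
  rw [← hE] at hω
  have hqt1 : 1 ≤ q ^ t := Nat.one_le_pow _ _ (by omega)
  have hEmul : q ^ t - 1 = (q - 1) * E := by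
    rw [hE, Nat.mul_div_cancel']
    have := Nat.sub_dvd_pow_sub_pow q 1 t
    rwa [one_pow] at this
  have hqt2 : 1 < q ^ t := Nat.one_lt_pow ht.ne_zero (by omega)
  have hE0 : 0 < E := by
    rcases Nat.eq_zero_or_pos E with h | h
    · rw [h] at hEmul; omega
    · exact h
  have hEt : (E : ZMod N) = t := by
    rw [hE, ← Nat.geomSum_eq (by omega)]
    push_cast
    simp [hqN]
  have htt : (t : ZMod N) * tinv = 1 := by
    have := (ZMod.natCast_eq_natCast_iff _ _ _).2 htinv
    push_cast at this
    exact this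
  have hγ0 : γ ≠ 0 := by
    rintro rfl
    have := pow_orderOf_eq_one (0 : K)
    rw [zero_pow (by omega)] at this
    exact zero_ne_one this
  have hω0 : ω ≠ 0 := by rw [hω]; exact pow_ne_zero _ hγ0
  have hordω : orderOf ω = q - 1 := by
    rw [hω, orderOf_pow_of_dvd hE0.ne' (by rw [hγ, hEmul]; exact Dvd.intro_left _ rfl), hγ, hEmul,
      Nat.mul_div_cancel _ hE0]
  have hordω' : orderOf ω = N * c := by omega
  have hordγ' : orderOf γ = N * (c * E) := by
    rw [hγ, hEmul, ← mul_assoc]; congr 1; omega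
  have hωq : ω ^ q = ω := by
    have : ω ^ (q - 1 + 1) = ω := by rw [pow_succ, ← hordω, pow_orderOf_eq_one, one_mul]
    rwa [Nat.sub_add_cancel (by omega)] at this
  have hchar : CharP K p := by
    refine charP_of_card_eq_prime_pow (p := p) (f := f * s * t) ?_
    rw [hK, hq, ← pow_mul]
  -- logarithms
  have hlogK : ∀ x : K, x ≠ 0 → ∃ n : ℕ, γ ^ n = x :=
    exists_log γ (by rw [hγ, hK])
  have hmemD' : ∀ n : ℕ, γ ^ n ∈ D' ↔ ∃ i ∈ I, (i : ZMod N) = n := by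
    intro n
    have := mem_D_iff N (c * E) 1 (by positivity) hN0 γ hordγ' I n
    simp only [one_mul, Finset.mem_image] at this
    rw [hD']
    exact this
  have hmemDt : ∀ n : ℕ, ω ^ n ∈ Dt ↔ ∃ i ∈ I, ((tinv * i : ℕ) : ZMod N) = n := by
    intro n
    have := mem_D_iff N c tinv hc0 hN0 ω hordω' I n
    simp only [Finset.mem_image] at this
    rw [hDt]
    exact this
  have h0D' : (0 : K) ∉ D' := by
    rw [hD']; rintro ⟨i, _, j, h⟩; exact pow_ne_zero _ hγ0 h.symm
  have h0Dt : (0 : K) ∉ Dt := by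
    rw [hDt]; rintro ⟨i, _, j, h⟩; exact pow_ne_zero _ hω0 h.symm
  have hlogL : ∀ x : K, x ≠ 0 → x ^ q = x → ∃ n : ℕ, ω ^ n = x := by
    intro x hx hxq
    obtain ⟨n, rfl⟩ := hlogK x hx
    have h1 : γ ^ (n * (q - 1)) = 1 := by
      have h2 : γ ^ n * γ ^ (n * (q - 1)) = γ ^ n * 1 := by
        rw [mul_one, ← pow_add]
        have : n + n * (q - 1) = n * q := by
          obtain ⟨q', rfl⟩ : ∃ q', q = q' + 1 := ⟨q - 1, by omega⟩
          simp; ring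
        rw [this, pow_mul, hxq]
      exact mul_left_cancel₀ hx h2
    have h3 := orderOf_dvd_of_pow_eq_one h1
    rw [hγ, hEmul, mul_comm n] at h3
    obtain ⟨k, rfl⟩ := (Nat.mul_dvd_mul_iff_left (by omega)).1 h3
    exact ⟨k, by rw [hω, pow_mul]⟩
  have hωnq : ∀ n : ℕ, (ω ^ n) ^ q = ω ^ n := by
    intro n; rw [← pow_mul, mul_comm, pow_mul, hωq]
  have hDtL : ∀ x ∈ Dt, x ^ q = x := by
    intro x hx
    rw [hDt] at hx
    obtain ⟨i, _, j, rfl⟩ := hx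
    exact hωnq _
  -- the Frobenius map
  obtain ⟨φ, hφ⟩ : ∃ φ : K →+* K, ∀ x, φ x = x ^ q :=
    ⟨iterateFrobenius K p (f * s), fun x => by rw [iterateFrobenius_def, hq]⟩
  have haq : a ^ q = a := by
    have : ∀ n : ℕ, a ^ p ^ n = a := by
      intro n
      induction n with
      | zero => simp
      | succ n ih => rw [pow_succ, pow_mul, ih, hap]
    rw [hq]; exact this _
  have hmod : ∀ k : ℕ, tripleInt (ω ^ k) a D' ≡ tripleInt (ω ^ k) a Dt [MOD t] := by
    intro k
    refine tripleInt_modEq q t ht φ hφ hK (ω ^ k) a (hωnq k) haq D' Dt ?_ ?_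
    · intro x hx
      have hx0 : x ≠ 0 := by rintro rfl; exact h0D' hx
      obtain ⟨n, rfl⟩ := hlogK x hx0
      rw [← pow_mul, hmemD']
      rw [hmemD'] at hx
      simpa [hqN] using hx
    · intro x
      by_cases hx0 : x = 0
      · subst hx0; simp [h0D', h0Dt]
      constructor
      · intro hx
        refine ⟨?_, hDtL x hx⟩
        obtain ⟨n, rfl⟩ := hlogL x hx0 (hDtL x hx)
        obtain ⟨i, hi, h⟩ := (hmemDt n).1 hx
        rw [hω, ← pow_mul, hmemD']
        refine ⟨i, hi, ?_⟩
        push_cast at h ⊢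
        rw [hEt, ← h, ← mul_assoc, htt, one_mul]
      · rintro ⟨hx, hxq⟩
        obtain ⟨n, rfl⟩ := hlogL x hx0 hxq
        rw [hω, ← pow_mul, hmemD'] at hx
        obtain ⟨i, hi, h⟩ := hx
        rw [hmemDt]
        refine ⟨i, hi, ?_⟩
        push_cast at h ⊢
        rw [h, hEt, ← mul_assoc, mul_comm (tinv : ZMod N), htt, one_mul]
  -- periodicity
  have hper : ∀ n j : ℕ, tripleInt (γ ^ (n + N * j)) a D' = tripleInt (γ ^ n) a D' := by
    intro n j
    rw [add_comm, pow_add]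
    refine tripleInt_smul _ _ _ (pow_ne_zero _ hγ0) _ ?_
    intro x
    by_cases hx : x = 0
    · subst hx; simp
    · obtain ⟨k, rfl⟩ := hlogK x hx
      rw [← pow_add, hmemD', hmemD']
      simp
  have hper2 : ∀ n n' : ℕ, (n : ZMod N) = n' →
      tripleInt (γ ^ n) a D' = tripleInt (γ ^ n') a D' := by
    intro n n' h
    rw [ZMod.natCast_eq_natCast_iff] at h
    rw [← Nat.mod_add_div n N, ← Nat.mod_add_div n' N, hper, hper, h]
  -- the two images
  have himg : (Finset.range N).image (fun ℓ => ((tripleInt (γ ^ ℓ) a D' : ℕ) : ZMod t)) =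
      ((Finset.range N).image (fun ℓ => tripleInt (ω ^ ℓ) a Dt)).image (fun n : ℕ => (n : ZMod t)) := by
    have hcast : ∀ k : ℕ, ((tripleInt (ω ^ k) a Dt : ℕ) : ZMod t) =
        ((tripleInt (γ ^ (E * k)) a D' : ℕ) : ZMod t) := by
      intro k
      rw [pow_mul, ← hω, ZMod.natCast_eq_natCast_iff]
      exact (hmod k).symm
    rw [Finset.image_image]
    ext z
    simp only [Finset.mem_image, Finset.mem_range, Function.comp]
    constructor
    · rintro ⟨l, hl, rfl⟩
      refine ⟨(tinv * l) % N, Nat.mod_lt _ hN0, ?_⟩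
      rw [hcast]
      congr 1
      apply hper2
      push_cast
      rw [ZMod.natCast_mod]
      push_cast
      rw [hEt, ← mul_assoc, htt, one_mul]
    · rintro ⟨k, hk, rfl⟩
      refine ⟨(E * k) % N, Nat.mod_lt _ hN0, ?_⟩
      rw [hcast]
      congr 1
      apply hper2
      rw [ZMod.natCast_mod]
  rw [himg, Finset.card_image_of_injOn, hu]
  -- the subfield with `q` elements
  obtain ⟨L, hL⟩ : ∃ L : Subfield K, ∀ x, x ∈ L ↔ x ^ q = x := by
    refine ⟨φ.eqLocusField (RingHom.id K), fun x => ?_⟩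
    change φ x = x ↔ _
    rw [hφ]
  obtain ⟨w, hw⟩ : ∃ w : L, (w : K) = ω := ⟨⟨ω, (hL _).2 hωq⟩, rfl⟩
  obtain ⟨b, hb⟩ : ∃ b : L, (b : K) = a := ⟨⟨a, (hL _).2 haq⟩, rfl⟩
  have hordw : orderOf w = q - 1 := by
    rw [← hordω, ← hw]
    exact (orderOf_injective (L.subtype : L →* K) Subtype.val_injective w).symm
  have hw0 : w ≠ 0 := by rintro rfl; exact hω0 (by rw [← hw]; simp)
  have hLcard : Fintype.card L = q := by
    have h1 : ∀ x : Lˣ, x ∈ Subgroup.zpowers (Units.mk0 w hw0) := by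
      intro x
      have hx : ((x : L) : K) ≠ 0 := by
        intro h
        exact x.ne_zero (Subtype.ext h)
      obtain ⟨n, hn⟩ := hlogL _ hx ((hL _).1 (x : L).2)
      refine ⟨n, Units.ext (Subtype.ext ?_)⟩
      simp [hw, hn]
    have h2 := orderOf_eq_card_of_forall_mem_zpowers h1
    rw [← orderOf_units, Units.val_mk0, hordw, Nat.card_eq_fintype_card, Fintype.card_units] at h2
    have := Fintype.one_lt_card (α := L)
    omega
  obtain ⟨DL, hDL⟩ : ∃ DL : Set L, DL = {x : L | ∃ i ∈ I, ∃ j : ℕ, x = w ^ (tinv * i + N * j)} :=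
    ⟨_, rfl⟩
  have hDLm : ∀ x : L, x ∈ DL ↔ (x : K) ∈ Dt := by
    intro x
    rw [hDL, hDt]
    constructor
    · rintro ⟨i, hi, j, h⟩
      exact ⟨i, hi, j, by rw [h]; simp [hw]⟩
    · rintro ⟨i, hi, j, h⟩
      exact ⟨i, hi, j, Subtype.ext (by rw [h]; simp [hw])⟩
  have htr : ∀ k : ℕ, tripleInt (ω ^ k) a Dt = tripleInt (w ^ k) b DL := by
    intro k
    unfold tripleInt
    rw [← Set.ncard_image_of_injective _ (Subtype.val_injective : Function.Injective
      (Subtype.val : L → K))]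
    congr 1
    ext x
    constructor
    · rintro ⟨h0, h1, h2⟩
      refine ⟨⟨x, (hL x).2 (hDtL x h0)⟩, ⟨(hDLm _).2 h0, (hDLm _).2 ?_, (hDLm _).2 ?_⟩, rfl⟩
      · simpa [hw] using h1
      · simpa [hw, hb] using h2
    · rintro ⟨y, ⟨h0, h1, h2⟩, rfl⟩
      refine ⟨(hDLm _).1 h0, ?_, ?_⟩
      · simpa [hw] using (hDLm _).1 h1
      · simpa [hw, hb] using (hDLm _).1 h2
  have hsqq : Real.sqrt q * Real.sqrt q = q := Real.mul_self_sqrt (Nat.cast_nonneg _)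
  have hsq0 : 0 ≤ Real.sqrt q := Real.sqrt_nonneg _
  have hbound : ∀ k l : ℕ, |(tripleInt (ω ^ k) a Dt : ℝ) - tripleInt (ω ^ l) a Dt| < t := by
    intro k l
    rw [htr, htr]
    by_cases hbig : 16 * N ^ 6 ≤ q
    · have hcharL : CharP L p := by
        refine charP_of_card_eq_prime_pow (p := p) (f := f * s) ?_
        rw [hLcard, hq]
      have hb0 : b ≠ 0 := by rintro rfl; exact ha0 (by rw [← hb]; simp)
      have hb1 : b ≠ 1 := by rintro rfl; exact ha1 (by rw [← hb]; simp)
      have h1 := F_side (F := L) p (f * s) q hq hLcard p1 m N (p1 ^ m) c hp1 hp1o rfl hN hN14 hbig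
        hc w hordw tinv I b hb0 hb1 DL hDL k l
      exact lt_of_le_of_lt (h1.trans (final_numeric N hN14 _ hsq0)) htbig
    · have hle : ∀ k : ℕ, (tripleInt (w ^ k) b DL : ℝ) ≤ q := by
        intro k
        have h1 : tripleInt (w ^ k) b DL ≤ q := by
          rw [← hLcard, ← Nat.card_eq_fintype_card]
          exact Set.ncard_le_card _
        exact_mod_cast h1
      have hqt : (q : ℝ) < t := by
        refine lt_of_le_of_lt ?_ htbig
        have h1 : Real.sqrt q ≤ 4 * N ^ 3 := by
          apply Real.sqrt_le_iff.2 ⟨by positivity, ?_⟩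
          have h2 : (q : ℝ) ≤ 16 * N ^ 6 := by exact_mod_cast (not_le.1 hbig).le
          calc (q : ℝ) ≤ 16 * N ^ 6 := h2
            _ = _ := by ring
        calc (q : ℝ) = Real.sqrt q * Real.sqrt q := hsqq.symm
          _ ≤ _ := mul_le_mul_of_nonneg_right h1 hsq0
      have h1 := hle k
      have h2 := hle l
      have h3 : (0 : ℝ) ≤ tripleInt (w ^ k) b DL := Nat.cast_nonneg _
      have h4 : (0 : ℝ) ≤ tripleInt (w ^ l) b DL := Nat.cast_nonneg _
      rw [abs_lt]
      constructor <;> linarith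
  intro x hx y hy hxy
  rw [Finset.mem_coe, Finset.mem_image] at hx hy
  obtain ⟨k, _, rfl⟩ := hx
  obtain ⟨l, _, rfl⟩ := hy
  exact natcast_inj t _ _ hxy (hbound k l)
end

section
/- Let q = p^f with p prime, let χ be a multiplicative character of F_q of order N > 1, let a ∈ F_p^* \ {1} (regarded in F_q), let i1, i2, i3 be integers with i1, i2, i3 ≢ 0 (mod N), and set f(x) = x^{i1}(x+1)^{i2}(x+a)^{i3}. Assume that, whenever χ^{i2}χ^{i3} is nontrivial, p divides J(χ^{i2}, χ^{i3}) · J(χ^{i1}, χ^{i2}χ^{i3}) in the ring of algebraic integers. Then for every odd positive integer t, Σ_{x∈F_{q^t}} χ'(f(x)) ≡ (Σ_{x∈F_q} χ(f(x)))^t (mod p) in the ring of algebraic integers, where χ' is the lift of χ to F_{q^t} and χ(f(x)) denotes χ^{i1}(x)χ^{i2}(x+1)χ^{i3}(x+a) with the convention χ(0) = 0. -/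
/-- Congruence modulo `n` in the ring of algebraic integers: `(u - v)/n` is an
algebraic integer. -/
def AlgIntModEq (n : ℕ) (u v : ℂ) : Prop :=
  ∃ w : ℂ, IsIntegral ℤ w ∧ u - v = n * w

open Polynomial

section Recur
variable {F : Type*} [Field F] [Fintype F]

theorem monicSet_finite (n : ℕ) : {g : F[X] | g.Monic ∧ g.natDegree = n}.Finite := by
  have e := (monicEquivDegreeLT (R := F) n).trans (degreeLTEquiv F n).toEquiv
  exact Set.finite_coe_iff.mp (Finite.of_equiv _ e.symm)

variable (F) in
noncomputable def monicFin (n : ℕ) : Finset F[X] := (monicSet_finite (F := F) n).toFinset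

theorem mem_monicFin {n : ℕ} {g : F[X]} : g ∈ monicFin F n ↔ g.Monic ∧ g.natDegree = n := by
  simp [monicFin]

open Classical in
variable (F) in
noncomputable def irrFin (B : ℕ) : Finset F[X] :=
  ((Finset.range (B + 1)).biUnion (monicFin F)).filter Irreducible

theorem mem_irrFin {B : ℕ} {g : F[X]} :
    g ∈ irrFin F B ↔ (g.Monic ∧ g.natDegree ≤ B) ∧ Irreducible g := by
  classical
  simp only [irrFin, Finset.mem_filter, Finset.mem_biUnion, Finset.mem_range, mem_monicFin]
  constructor
  · rintro ⟨⟨n, hn, h1, h2⟩, h3⟩; exact ⟨⟨h1, by omega⟩, h3⟩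
  · rintro ⟨⟨h1, h2⟩, h3⟩; exact ⟨⟨_, by omega, h1, rfl⟩, h3⟩

open UniqueFactorizationMonoid in
open Classical in
theorem natDegree_eq_sum_irr {B : ℕ} {g : F[X]} (hg : g.Monic) (hB : g.natDegree ≤ B) :
    g.natDegree = ∑ P ∈ irrFin F B, ∑ k ∈ Finset.Icc 1 B,
      if P ^ k ∣ g then P.natDegree else 0 := by
  have h0 : g ≠ 0 := hg.ne_zero
  have h1 : (normalizedFactors g).prod = g := by
    rw [prod_normalizedFactors_eq, hg.normalize_eq_self]
    try exact h0
  have hdeg : g.natDegree = ((normalizedFactors g).map natDegree).sum := by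
    conv_lhs => rw [← h1]
    exact natDegree_multiset_prod _ (zero_notMem_normalizedFactors g)
  rw [hdeg, Finset.sum_multiset_map_count]
  have hsub : (normalizedFactors g).toFinset ⊆ irrFin F B := by
    intro P hP
    rw [Multiset.mem_toFinset] at hP
    have hirr := irreducible_of_normalized_factor P hP
    have hn := normalize_normalized_factor P hP
    rw [mem_irrFin]
    refine ⟨⟨?_, ?_⟩, hirr⟩
    · rw [← hn]; exact monic_normalize hirr.ne_zero
    · exact (natDegree_le_of_dvd (dvd_of_mem_normalizedFactors hP) h0).trans hB
  rw [Finset.sum_subset hsub]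
  · refine Finset.sum_congr rfl fun P hP => ?_
    rw [mem_irrFin] at hP
    obtain ⟨⟨hm, -⟩, hirr⟩ := hP
    have hd : ∀ k, P ^ k ∣ g ↔ k ≤ (normalizedFactors g).count P := by
      intro k
      rw [pow_dvd_iff_le_emultiplicity, emultiplicity_eq_count_normalizedFactors hirr h0,
        hm.normalize_eq_self]
      exact Nat.cast_le
    have hc : (normalizedFactors g).count P ≤ B := by
      have := natDegree_le_of_dvd ((hd _).2 le_rfl) h0
      rw [natDegree_pow] at this
      have h2 := hirr.natDegree_pos
      nlinarith
    simp only [hd]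
    rw [← Finset.sum_filter, Finset.sum_const]
    congr 1
    have : (Finset.Icc 1 B).filter (· ≤ (normalizedFactors g).count P)
        = Finset.Icc 1 ((normalizedFactors g).count P) := by
      ext k; simp only [Finset.mem_filter, Finset.mem_Icc]; omega
    rw [this]; simp
  · intro P _ hP
    rw [Multiset.mem_toFinset] at hP
    rw [Multiset.count_eq_zero_of_notMem hP, zero_smul]

variable {R : Type*} [CommRing R] (ψ : F[X] →* R)

noncomputable def cSum (n : ℕ) : R := ∑ g ∈ monicFin F n, ψ g

noncomputable def tSum (B t : ℕ) : R :=
  ∑ P ∈ irrFin F B, ∑ k ∈ Finset.Icc 1 B,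
    if k * P.natDegree = t then (P.natDegree : R) * ψ P ^ k else 0

open Classical in
theorem sum_dvd {P : F[X]} (hP : P.Monic) (k n : ℕ) :
    (∑ g ∈ monicFin F n, if P ^ k ∣ g then ψ g else 0)
      = if k * P.natDegree ≤ n then ψ P ^ k * cSum ψ (n - k * P.natDegree) else 0 := by
  rw [← Finset.sum_filter]
  have hPk : (P ^ k).Monic := hP.pow k
  have hdk : (P ^ k).natDegree = k * P.natDegree := natDegree_pow _ _
  split_ifs with h
  · rw [cSum, Finset.mul_sum]
    symm
    refine Finset.sum_bij (fun g _ => P ^ k * g) ?_ ?_ ?_ ?_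
    · intro g hg
      rw [mem_monicFin] at hg
      simp only [Finset.mem_filter, mem_monicFin]
      refine ⟨⟨hPk.mul hg.1, ?_⟩, dvd_mul_right _ _⟩
      rw [hPk.natDegree_mul hg.1, hdk, hg.2]; omega
    · intro g _ g' _ h
      exact mul_left_cancel₀ hPk.ne_zero h
    · intro g hg
      simp only [Finset.mem_filter, mem_monicFin] at hg
      obtain ⟨⟨hm, hn⟩, g', rfl⟩ := hg
      have hm' : g'.Monic := hPk.of_mul_monic_left hm
      refine ⟨g', ?_, rfl⟩
      rw [mem_monicFin]
      rw [hPk.natDegree_mul hm', hdk] at hn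
      exact ⟨hm', by omega⟩
    · intro g _
      rw [map_mul, map_pow]
  · refine Finset.sum_eq_zero fun g hg => ?_
    simp only [Finset.mem_filter, mem_monicFin] at hg
    exfalso
    have := natDegree_le_of_dvd hg.2 hg.1.1.ne_zero
    omega

theorem newton_rec {B n : ℕ} (hn : n ≤ B) :
    (n : R) * cSum ψ n = ∑ t ∈ Finset.Icc 1 n, tSum ψ B t * cSum ψ (n - t) := by
  classical
  have h1 : (n : R) * cSum ψ n = ∑ P ∈ irrFin F B, ∑ k ∈ Finset.Icc 1 B,
      (P.natDegree : R) * (∑ g ∈ monicFin F n, if P ^ k ∣ g then ψ g else 0) := by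
    rw [cSum, Finset.mul_sum]
    simp_rw [Finset.mul_sum]
    rw [Finset.sum_congr rfl fun P _ => Finset.sum_comm, Finset.sum_comm]
    refine Finset.sum_congr rfl fun g hg => ?_
    rw [mem_monicFin] at hg
    have := natDegree_eq_sum_irr hg.1 (hg.2.le.trans hn)
    conv_lhs => rw [← hg.2, this]
    push_cast
    rw [Finset.sum_mul]
    refine Finset.sum_congr rfl fun P _ => ?_
    rw [Finset.sum_mul]
    refine Finset.sum_congr rfl fun k _ => ?_
    split_ifs <;> simp
  rw [h1]
  simp_rw [tSum, Finset.sum_mul]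
  conv_rhs => rw [Finset.sum_comm]
  refine Finset.sum_congr rfl fun P hP => ?_
  conv_rhs => rw [Finset.sum_comm]
  refine Finset.sum_congr rfl fun k hk => ?_
  rw [mem_irrFin] at hP
  rw [sum_dvd ψ hP.1.1]
  simp only [ite_mul, zero_mul]
  rw [Finset.sum_ite_eq]
  have hpos : 0 < k * P.natDegree :=
    Nat.mul_pos (Finset.mem_Icc.1 hk).1 hP.2.natDegree_pos
  by_cases h : k * P.natDegree ≤ n
  · rw [if_pos h, if_pos (Finset.mem_Icc.2 ⟨hpos, h⟩)]; ring
  · rw [if_neg h, if_neg (fun h' => h (Finset.mem_Icc.1 h').2), mul_zero]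

theorem cSum_zero : cSum ψ 0 = 1 := by
  have : monicFin F 0 = {1} := by
    ext g
    rw [mem_monicFin, Finset.mem_singleton]
    constructor
    · rintro ⟨h, h'⟩; exact h.natDegree_eq_zero.1 h'
    · rintro rfl; exact ⟨monic_one, natDegree_one⟩
  rw [cSum, this]; simp

end Recur

section Points
variable {F : Type*} [Field F] [Fintype F] {E : Type*} [Field E] [Fintype E] [Algebra F E]
open IntermediateField Module

theorem norm_sub_eq (s : F) (y : E) :
    Algebra.norm F (algebraMap F E s - y) =
      ((minpoly F y).eval s) ^ (finrank F E / (minpoly F y).natDegree) := by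
  have hy : IsIntegral F y := Algebra.IsIntegral.isIntegral y
  set L := F⟮y⟯
  have hL : (algebraMap F E s - y) = algebraMap L E (algebraMap F L s - AdjoinSimple.gen F y) := by
    simp [L]
  rw [hL, ← Algebra.norm_norm (R := F) (S := L), Algebra.norm_algebraMap, map_pow]
  have hfin : finrank F L = (minpoly F y).natDegree := adjoin.finrank hy
  congr 1
  · let pb := adjoin.powerBasis hy
    have hg : pb.gen = AdjoinSimple.gen F y := by simp [pb]
    rw [Algebra.norm_eq_matrix_det pb.basis, ← hg]
    have h2 := charpoly_leftMulMatrix pb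
    have h3 : minpoly F pb.gen = minpoly F y := by rw [hg]; exact minpoly_gen F y
    rw [← h3, ← h2, Matrix.eval_charpoly]
    congr 1
    rw [map_sub, AlgHom.commutes]
    rfl
  · rw [← hfin, ← finrank_mul_finrank F L E]
    exact (Nat.mul_div_cancel_left _ finrank_pos).symm

theorem card_minpoly_eq {P : F[X]} (hP : P.Monic) (hirr : Irreducible P)
    (hd : P.natDegree ∣ finrank F E) [DecidableEq F[X]] :
    ((Finset.univ : Finset E).filter (fun y => minpoly F y = P)).card = P.natDegree := by
  classical
  have h1 := hirr.natDegree_dvd_iff_dvd_X_pow_card_pow_sub_X.1 hd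
  rw [← Module.natCard_eq_pow_finrank (K := F) (V := E), Nat.card_eq_fintype_card] at h1
  have hsplit : (P.map (algebraMap F E)).Splits := by
    refine Splits.of_dvd ?_ ?_ (Polynomial.map_dvd (algebraMap F E) h1)
    · exact IsSplittingField.splits E _
    · exact Polynomial.map_ne_zero
        (FiniteField.X_pow_card_sub_X_ne_zero F Fintype.one_lt_card)
  have hsep : P.Separable := PerfectField.separable_of_irreducible hirr
  rw [← card_rootSet_eq_natDegree hsep hsplit, ← Set.toFinset_card]
  congr 1
  ext y
  rw [Finset.mem_filter, Set.mem_toFinset, mem_rootSet]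
  constructor
  · rintro ⟨-, rfl⟩; exact ⟨hP.ne_zero, minpoly.aeval _ _⟩
  · rintro ⟨-, h⟩; exact ⟨Finset.mem_univ _, (minpoly.eq_of_irreducible_of_monic hirr h hP).symm⟩

theorem tSum_eq {R : Type*} [CommRing R] (ψ : F[X] →* R) {t : ℕ} (ht : finrank F E = t) :
    tSum ψ t t = ∑ y : E, ψ (minpoly F y) ^ (t / (minpoly F y).natDegree) := by
  classical
  subst ht
  have hdvd : ∀ y : E, (minpoly F y).natDegree ∣ finrank F E := fun y =>
    minpoly.degree_dvd (Algebra.IsIntegral.isIntegral y)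
  have hmap : ∀ y ∈ (Finset.univ : Finset E), minpoly F y ∈ irrFin F (finrank F E) := by
    intro y _
    have hy : IsIntegral F y := Algebra.IsIntegral.isIntegral y
    rw [mem_irrFin]
    exact ⟨⟨minpoly.monic hy, Nat.le_of_dvd finrank_pos (hdvd y)⟩, minpoly.irreducible hy⟩
  rw [← Finset.sum_fiberwise_of_maps_to hmap, tSum]
  refine Finset.sum_congr rfl fun P hP => ?_
  rw [mem_irrFin] at hP
  obtain ⟨⟨hm, hle⟩, hirr⟩ := hP
  have hpos := hirr.natDegree_pos
  have hrhs : ∑ y : E with minpoly F y = P,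
      ψ (minpoly F y) ^ (finrank F E / (minpoly F y).natDegree) =
      ∑ y : E with minpoly F y = P, ψ P ^ (finrank F E / P.natDegree) :=
    Finset.sum_congr rfl fun y hy => by rw [(Finset.mem_filter.1 hy).2]
  rw [hrhs, Finset.sum_const]
  by_cases hd : P.natDegree ∣ finrank F E
  · rw [card_minpoly_eq hm hirr hd, nsmul_eq_mul, Finset.sum_eq_single (finrank F E / P.natDegree)]
    · rw [if_pos (Nat.div_mul_cancel hd)]
    · intro k _ hk
      rw [if_neg]
      intro h
      exact hk (by rw [← h, Nat.mul_div_cancel _ hpos])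
    · intro h
      exfalso
      exact h (Finset.mem_Icc.2 ⟨Nat.div_pos hle hpos, Nat.div_le_self _ _⟩)
  · rw [Finset.sum_eq_zero, Finset.card_eq_zero.2, zero_smul]
    · rw [Finset.filter_eq_empty_iff]
      rintro y - rfl
      exact hd (hdvd y)
    · intro k _
      rw [if_neg]
      rintro h
      exact hd ⟨k, by rw [← h, mul_comm]⟩
end Points

section Chars
variable {F : Type*} [Field F] [Fintype F]

noncomputable def psi (χ₁ χ₂ χ₃ : MulChar F ℂ) (a : F) : F[X] →* ℂ where
  toFun g := χ₁ (g.eval 0) * χ₂ (g.eval 1) * χ₃ (g.eval a)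
  map_one' := by simp
  map_mul' g h := by simp only [eval_mul, map_mul]; ring

theorem psi_apply (χ₁ χ₂ χ₃ : MulChar F ℂ) (a : F) (g : F[X]) :
    psi χ₁ χ₂ χ₃ a g = χ₁ (g.eval 0) * χ₂ (g.eval 1) * χ₃ (g.eval a) := rfl

theorem cSum_ge_three {χ₁ χ₂ χ₃ : MulChar F ℂ} {a : F} (ha0 : a ≠ 0) (hχ : χ₁ ≠ 1)
    {n : ℕ} (hn : 3 ≤ n) : cSum (psi χ₁ χ₂ χ₃ a) n = 0 := by
  set h : F[X] := C a⁻¹ * ((X - C 1) * (X - C a)) with hh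
  have hdeg : ∀ r : F, (C r * h).natDegree < n := by
    intro r
    refine lt_of_le_of_lt ?_ hn
    rw [hh]
    compute_degree
  have hdeg' : ∀ (r : F) (g : F[X]), g ∈ monicFin F n → (C r * h).degree < g.degree := by
    intro r g hg
    rw [mem_monicFin] at hg
    exact degree_lt_degree (by rw [hg.2]; exact hdeg r)
  have hmem : ∀ (r : F) (g : F[X]), g ∈ monicFin F n → g + C r * h ∈ monicFin F n := by
    intro r g hg
    have h1 := hdeg' r g hg
    rw [mem_monicFin] at hg ⊢
    refine ⟨hg.1.add_of_left h1, ?_⟩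
    rw [natDegree_add_eq_left_of_degree_lt h1, hg.2]
  have hshift : ∀ r : F, cSum (psi χ₁ χ₂ χ₃ a) n =
      ∑ g ∈ monicFin F n, psi χ₁ χ₂ χ₃ a (g + C r * h) := by
    intro r
    symm
    refine Finset.sum_bij' (fun g _ => g + C r * h) (fun g _ => g + C (-r) * h)
      (fun g hg => hmem r g hg) (fun g hg => hmem (-r) g hg) ?_ ?_ ?_
    · intro g _; simp
    · intro g _; simp
    · intro g _; rfl
  have h0 : h.eval 0 = 1 := by simp [hh, ha0]
  have h1 : h.eval 1 = 0 := by simp [hh]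
  have h2 : h.eval a = 0 := by simp [hh]
  have hq : (Fintype.card F : ℂ) * cSum (psi χ₁ χ₂ χ₃ a) n = 0 := by
    have : (Fintype.card F : ℂ) * cSum (psi χ₁ χ₂ χ₃ a) n
        = ∑ r : F, cSum (psi χ₁ χ₂ χ₃ a) n := by simp
    rw [this, Finset.sum_congr rfl fun r _ => hshift r, Finset.sum_comm]
    refine Finset.sum_eq_zero fun g _ => ?_
    simp only [psi_apply, eval_add, eval_mul, eval_C, h0, h1, h2, mul_zero, mul_one, add_zero]
    rw [← Finset.sum_mul, ← Finset.sum_mul]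
    have h3 : ∑ r : F, χ₁ (eval 0 g + r) = 0 := by
      rw [← MulChar.sum_eq_zero_of_ne_one hχ]
      exact Fintype.sum_equiv (Equiv.addLeft (eval 0 g)) _ _ (fun r => rfl)
    rw [h3, zero_mul, zero_mul]
  exact (mul_eq_zero.1 hq).resolve_left (Nat.cast_ne_zero.2 Fintype.card_ne_zero)

theorem cSum_one (χ₁ χ₂ χ₃ : MulChar F ℂ) (a : F) :
    cSum (psi χ₁ χ₂ χ₃ a) 1 = ∑ x : F, χ₁ x * χ₂ (x + 1) * χ₃ (x + a) := by
  symm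
  refine Finset.sum_bij' (fun x _ => X + C x) (fun g _ => g.coeff 0) ?_ ?_ ?_ ?_ ?_
  · intro x _; rw [mem_monicFin]; exact ⟨monic_X_add_C x, natDegree_X_add_C x⟩
  · intro g _; exact Finset.mem_univ _
  · intro x _; simp
  · intro g hg
    rw [mem_monicFin] at hg
    exact (hg.1.eq_X_add_C hg.2).symm
  · intro x _
    simp [psi_apply, add_comm]

theorem cSum_two (χ₁ χ₂ χ₃ : MulChar F ℂ) {a : F} (ha0 : a ≠ 0) (ha1 : a ≠ 1) :
    cSum (psi χ₁ χ₂ χ₃ a) 2 = (χ₁ a * χ₂ (1 - a) * χ₃ (a * (a - 1))) *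
      ∑ u : F, ∑ v : F, χ₁ u * (χ₂ v * χ₃ (1 - u - v)) := by
  have h1a : 1 - a ≠ 0 := sub_ne_zero.2 (Ne.symm ha1)
  rw [← Fintype.sum_prod_type', Finset.mul_sum]
  symm
  refine Finset.sum_bij'
    (fun x _ => X ^ 2 + C ((1 - a) * x.2 - 1 - a * x.1) * X + C (a * x.1))
    (fun g _ => (g.eval 0 / a, g.eval 1 / (1 - a))) ?_ ?_ ?_ ?_ ?_
  · rintro ⟨u, v⟩ _
    rw [mem_monicFin]
    constructor
    · monicity!
    · compute_degree!
  · intro g _; exact Finset.mem_univ _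
  · rintro ⟨u, v⟩ _
    ext
    · simp; field_simp
    · simp; field_simp; ring
  · intro g hg
    rw [mem_monicFin] at hg
    have hg' : g = X ^ 2 + C (g.coeff 1) * X + C (g.coeff 0) := by
      conv_lhs => rw [hg.1.as_sum, hg.2]
      simp [Finset.sum_range_succ]; ring
    generalize g.coeff 1 = b at hg'
    generalize g.coeff 0 = c at hg'
    subst hg'
    have e1 : a * (c / a) = c := by field_simp
    have e2 : (1 - a) * ((1 + b + c) / (1 - a)) = 1 + b + c := by field_simp
    simp [e1, e2]
    ring
  · rintro ⟨u, v⟩ _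
    have e : a * (a - 1) * (1 - u - v) = a ^ 2 + ((1 - a) * v - 1 - a * u) * a + a * u := by ring
    simp only [psi_apply, eval_add, eval_mul, eval_pow, eval_X, eval_C]
    rw [← e]
    have e1 : (0 : F) ^ 2 + ((1 - a) * v - 1 - a * u) * 0 + a * u = a * u := by ring
    have e2 : (1 : F) ^ 2 + ((1 - a) * v - 1 - a * u) * 1 + a * u = (1 - a) * v := by ring
    rw [e1, e2]
    simp only [map_mul]
    ring

theorem triple_sum (χ₁ χ₂ χ₃ : MulChar F ℂ) :
    ∑ u : F, ∑ v : F, χ₁ u * (χ₂ v * χ₃ (1 - u - v)) =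
      jacobiSum χ₂ χ₃ * jacobiSum χ₁ (χ₂ * χ₃) + χ₃ (-1) * ∑ v : F, (χ₂ * χ₃) v := by
  classical
  have key : ∀ u : F, ∑ v : F, χ₁ u * (χ₂ v * χ₃ (1 - u - v)) =
      jacobiSum χ₂ χ₃ * (χ₁ u * (χ₂ * χ₃) (1 - u)) +
        if u = 1 then χ₃ (-1) * ∑ v : F, (χ₂ * χ₃) v else 0 := by
    intro u
    by_cases hu : u = 1
    · subst hu
      rw [if_pos rfl, sub_self, MulChar.map_zero, mul_zero, mul_zero, zero_add, Finset.mul_sum]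
      refine Finset.sum_congr rfl fun v _ => ?_
      rw [map_one, zero_sub, neg_eq_neg_one_mul, map_mul, MulChar.mul_apply]; ring
    · rw [if_neg hu, add_zero, ← Finset.mul_sum]
      have hs : 1 - u ≠ 0 := sub_ne_zero.2 (Ne.symm hu)
      have : ∑ v : F, χ₂ v * χ₃ (1 - u - v) = jacobiSum χ₂ χ₃ * (χ₂ * χ₃) (1 - u) := by
        rw [jacobiSum, Finset.sum_mul]
        symm
        refine Fintype.sum_equiv (Equiv.mulLeft₀ (1 - u) hs) _ _ (fun v => ?_)
        have e : 1 - u - (1 - u) * v = (1 - u) * (1 - v) := by ring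
        simp only [Equiv.mulLeft₀_apply]
        rw [e, MulChar.mul_apply, map_mul, map_mul]; ring
      rw [this]; ring
  rw [Finset.sum_congr rfl fun u _ => key u, Finset.sum_add_distrib, ← Finset.mul_sum]
  simp [jacobiSum]

theorem isIntegral_mulChar (χ : MulChar F ℂ) (x : F) : IsIntegral ℤ (χ x) := by
  by_cases hx : x = 0
  · rw [hx, MulChar.map_zero]; exact isIntegral_zero
  · refine IsIntegral.of_pow (n := Fintype.card F - 1) (Nat.sub_pos_of_lt Fintype.one_lt_card) ?_
    rw [← map_pow, FiniteField.pow_card_sub_one_eq_one x hx, map_one]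
    exact isIntegral_one

end Chars

def DvdInt (p : ℕ) (u : ℂ) : Prop := ∃ w : ℂ, IsIntegral ℤ w ∧ u = p * w

theorem DvdInt.add {p : ℕ} {u v : ℂ} (hu : DvdInt p u) (hv : DvdInt p v) : DvdInt p (u + v) := by
  obtain ⟨w, hw, rfl⟩ := hu
  obtain ⟨w', hw', rfl⟩ := hv
  exact ⟨w + w', hw.add hw', by ring⟩

theorem DvdInt.mul {p : ℕ} {u v : ℂ} (hu : IsIntegral ℤ u) (hv : DvdInt p v) :
    DvdInt p (u * v) := by
  obtain ⟨w', hw', rfl⟩ := hv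
  exact ⟨u * w', hu.mul hw', by ring⟩

theorem DvdInt.sub {p : ℕ} {u v : ℂ} (hu : DvdInt p u) (hv : DvdInt p v) : DvdInt p (u - v) := by
  obtain ⟨w, hw, rfl⟩ := hu
  obtain ⟨w', hw', rfl⟩ := hv
  exact ⟨w - w', hw.sub hw', by ring⟩

theorem DvdInt.sum {ι : Type*} {p : ℕ} (s : Finset ι) {u : ι → ℂ} (h : ∀ i ∈ s, DvdInt p (u i)) :
    DvdInt p (∑ i ∈ s, u i) := by
  classical
  induction s using Finset.induction_on with
  | empty => exact ⟨0, isIntegral_zero, by simp⟩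
  | insert i s hi ih =>
    rw [Finset.sum_insert hi]
    exact (h i (Finset.mem_insert_self _ _)).add
      (ih fun j hj => h j (Finset.mem_insert_of_mem hj))

theorem isIntegral_natCast' (n : ℕ) : IsIntegral ℤ (n : ℂ) := by
  have := isIntegral_algebraMap (R := ℤ) (A := ℂ) (x := (n : ℤ))
  simpa using this

theorem tSum_congr {F : Type*} [Field F] [Fintype F] (ψ : F[X] →* ℂ)
    (hψ : ∀ g, IsIntegral ℤ (ψ g)) {p : ℕ} (hc : ∀ n, 2 ≤ n → DvdInt p (cSum ψ n)) (B : ℕ) :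
    ∀ n, n + 1 ≤ B → DvdInt p (tSum ψ B (n + 1) - (-1) ^ n * cSum ψ 1 ^ (n + 1)) := by
  have hT : ∀ t, IsIntegral ℤ (tSum ψ B t) := by
    intro t
    refine IsIntegral.sum _ fun P _ => IsIntegral.sum _ fun k _ => ?_
    split_ifs
    · exact (isIntegral_natCast' _).mul ((hψ P).pow k)
    · exact isIntegral_zero
  have hc1 : IsIntegral ℤ (cSum ψ 1) := IsIntegral.sum _ fun g _ => hψ g
  intro n
  induction n with
  | zero =>
    intro h
    have := newton_rec ψ h
    simp [cSum_zero] at this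
    exact ⟨0, isIntegral_zero, by simp [this]⟩
  | succ n ih =>
    intro h
    have ih := ih (by omega)
    have hr := newton_rec ψ h
    rw [Finset.sum_Icc_succ_top (by omega), Finset.sum_Icc_succ_top (by omega)] at hr
    have e1 : n + 1 + 1 - (n + 1) = 1 := by omega
    rw [e1, Nat.sub_self, cSum_zero] at hr
    have hsum : DvdInt p (∑ t ∈ Finset.Icc 1 n, tSum ψ B t * cSum ψ (n + 1 + 1 - t)) := by
      refine DvdInt.sum _ fun t ht => DvdInt.mul (hT t) (hc _ ?_)
      rw [Finset.mem_Icc] at ht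
      omega
    have hl := DvdInt.mul (isIntegral_natCast' (n + 1 + 1)) (hc (n + 1 + 1) (by omega))
    have := (hl.sub hsum).sub (DvdInt.mul hc1 ih)
    convert this using 1
    rw [hr]
    ring


theorem dvdInt_cSum_two {p f : ℕ} {F : Type*} [Field F] [Fintype F]
    (hF : Fintype.card F = p ^ f) {χ₁ χ₂ χ₃ : MulChar F ℂ} (h1 : χ₁ ≠ 1) (h2 : χ₂ ≠ 1)
    {a : F} (ha0 : a ≠ 0) (ha1 : a ≠ 1)
    (hJ : χ₂ * χ₃ ≠ 1 → DvdInt p (jacobiSum χ₂ χ₃ * jacobiSum χ₁ (χ₂ * χ₃))) :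
    DvdInt p (cSum (psi χ₁ χ₂ χ₃ a) 2) := by
  rw [cSum_two χ₁ χ₂ χ₃ ha0 ha1]
  refine DvdInt.mul (((isIntegral_mulChar _ _).mul (isIntegral_mulChar _ _)).mul
    (isIntegral_mulChar _ _)) ?_
  rw [triple_sum]
  by_cases h : χ₂ * χ₃ = 1
  · have h3 : χ₃ = χ₂⁻¹ := (inv_eq_of_mul_eq_one_right h).symm
    have hs : ∑ v : F, (1 : MulChar F ℂ) v = (Fintype.card F : ℂ) - 1 := by
      classical
      rw [MulChar.sum_one_eq_card_units, Fintype.card_units,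
        Nat.cast_sub Fintype.card_pos, Nat.cast_one]
    have hm : χ₃ (-1) = χ₂ (-1) := by
      rw [h3, MulChar.inv_apply', inv_neg_one]
    have hf : f ≠ 0 := by
      rintro rfl
      have := Fintype.one_lt_card (α := F)
      simp [hF] at this
    obtain ⟨f, rfl⟩ := Nat.exists_eq_succ_of_ne_zero hf
    rw [h, jacobiSum_comm χ₁, jacobiSum_one_nontrivial h1, hs, hm, h3, jacobiSum_nontrivial_inv h2,
      hF]
    refine ⟨χ₂ (-1) * (p ^ f : ℕ), (isIntegral_mulChar _ _).mul (isIntegral_natCast' _), ?_⟩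
    rw [Nat.succ_eq_add_one]
    push_cast
    ring
  · rw [MulChar.sum_eq_zero_of_ne_one h, mul_zero, add_zero]
    exact hJ h

/-- Proposition 2.5: let `χ` be a multiplicative character of `𝔽_q` (`q = p^f`) of order
`N > 1`, `a ∈ 𝔽_p^* \ {1}` (regarded in `𝔽_q`), and `i₁,i₂,i₃ ≢ 0 (mod N)`, and set
`f(x) = x^{i₁}(x+1)^{i₂}(x+a)^{i₃}`.  If `p` divides
`J(χ^{i₂},χ^{i₃})·J(χ^{i₁},χ^{i₂}χ^{i₃})` whenever `χ^{i₂}χ^{i₃}` is nontrivial, then for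
every odd positive `t`, `Σ_{x∈𝔽_{q^t}} χ'(f(x)) ≡ (Σ_{x∈𝔽_q} χ(f(x)))^t (mod p)` in the
ring of algebraic integers, where `χ'` is the lift of `χ` to `𝔽_{q^t}`. -/
theorem char_sum_lift_congruent_mod_char
    (p f : ℕ) (hp : p.Prime) (F : Type*) [Field F] [Fintype F]
    (hF : Fintype.card F = p ^ f)
    (N : ℕ) (hN : 1 < N) (χ : MulChar F ℂ) (hχ : orderOf χ = N)
    (a : F) (ha0 : a ≠ 0) (ha1 : a ≠ 1) (hap : a ^ p = a)
    (i1 i2 i3 : ℕ) (h1 : ¬ N ∣ i1) (h2 : ¬ N ∣ i2) (h3 : ¬ N ∣ i3)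
    (hJ : χ ^ (i2 + i3) ≠ 1 →
      ∃ w : ℂ, IsIntegral ℤ w ∧
        jacobiSum (χ ^ i2) (χ ^ i3) * jacobiSum (χ ^ i1) (χ ^ (i2 + i3)) = p * w) :
    ∀ t : ℕ, Odd t → 0 < t →
      ∀ (E : Type) [Field E] [Fintype E] [Algebra F E],
        Fintype.card E = p ^ (f * t) →
        ∀ χ' : MulChar E ℂ, (∀ x : E, χ' x = χ (Algebra.norm F x)) →
          AlgIntModEq p
            (∑ x : E, (χ' ^ i1) x * (χ' ^ i2) (x + 1) * (χ' ^ i3) (x + algebraMap F E a))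
            ((∑ x : F, (χ ^ i1) x * (χ ^ i2) (x + 1) * (χ ^ i3) (x + a)) ^ t) := by
  intro t hodd ht E _ _ _ hE χ' hχ'
  have hpow : ∀ i, ¬ N ∣ i → χ ^ i ≠ 1 := by
    intro i hi h
    exact hi (hχ ▸ orderOf_dvd_of_pow_eq_one h)
  have hne : ∀ i, ¬ N ∣ i → i ≠ 0 := by
    rintro i hi rfl
    exact hi (dvd_zero N)
  have hfin : Module.finrank F E = t := by
    have h := Module.card_eq_pow_finrank (K := F) (V := E)
    rw [hE, hF, pow_mul] at h
    have hq : 1 < p ^ f := hF ▸ Fintype.one_lt_card (α := F)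
    exact (Nat.pow_right_injective hq h).symm
  set ψ := psi (χ ^ i1) (χ ^ i2) (χ ^ i3) a with hψ
  have hc : ∀ n, 2 ≤ n → DvdInt p (cSum ψ n) := by
    intro n hn
    rcases hn.eq_or_lt with rfl | hn
    · refine dvdInt_cSum_two hF (hpow i1 h1) (hpow i2 h2) ha0 ha1 ?_
      rw [← pow_add]
      exact hJ
    · rw [hψ, cSum_ge_three ha0 (hpow i1 h1) hn]
      exact ⟨0, isIntegral_zero, by simp⟩
  have hψint : ∀ g, IsIntegral ℤ (ψ g) := fun g =>
    ((isIntegral_mulChar _ _).mul (isIntegral_mulChar _ _)).mul (isIntegral_mulChar _ _)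
  obtain ⟨m, hm⟩ := hodd
  have key := tSum_congr ψ hψint hc t (2 * m) hm.ge
  rw [← hm, pow_mul, neg_one_sq, one_pow, one_mul, tSum_eq (E := E) ψ hfin, hψ, cSum_one] at key
  have hval : ∀ i, ¬ N ∣ i → ∀ (s : F) (y : E), (χ' ^ i) (algebraMap F E s - y) =
      (χ ^ i) ((minpoly F y).eval s) ^ (t / (minpoly F y).natDegree) := by
    intro i hi s y
    rw [MulChar.pow_apply' _ (hne i hi), hχ', norm_sub_eq, hfin, map_pow,
      MulChar.pow_apply' _ (hne i hi), pow_right_comm]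
  have hS : ∑ x : E, (χ' ^ i1) x * (χ' ^ i2) (x + 1) * (χ' ^ i3) (x + algebraMap F E a) =
      ∑ y : E, (psi (χ ^ i1) (χ ^ i2) (χ ^ i3) a) (minpoly F y)
        ^ (t / (minpoly F y).natDegree) := by
    symm
    refine Fintype.sum_equiv (Equiv.neg E) _ _ fun y => ?_
    have e1 := hval i1 h1 0 y
    have e2 := hval i2 h2 1 y
    have e3 := hval i3 h3 a y
    rw [map_zero, zero_sub] at e1
    rw [map_one, sub_eq_neg_add] at e2
    rw [sub_eq_neg_add] at e3
    rw [Equiv.neg_apply, e1, e2, e3, psi_apply, mul_pow, mul_pow]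
  rw [hS]
  exact key
end
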